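/- arXiv:2403.04318 — 2 statements merged into one kernel-verified Lean document; each statement's English description precedes it below -/
import Mathlib

section
/- Let 𝒢 be a K_{s,t}^{(r)}-free r-uniform hypergraph on rn vertices with at least n^{r − 1/(s−1) − ε} edges, where ε > 0 and n is sufficiently large. Then 𝒢 has a subgraph ℋ that is (ε + (log₂ n)^{−1/2}, 4r·log₂^r n)-regular: ℋ is balanced r-partite with parts of size n, e(ℋ) ≥ n^{r − 1/(s−1) − ε − (log₂ n)^{−1/2}}, and for each part index i there is Δ_i with n^{1 − 1/(s−1) − ε′} ≤ Δ_i ≤ n^{1 − 1/(s−1) + ε′} (ε′ = ε + (log₂ n)^{−1/2}) such that every (r−1)-tuple T of ℋ avoiding part i satisfies Δ_i/(4r log₂^r n) ≤ d_ℋ(T) ≤ Δ_i. -/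
open Finset
open scoped Classical

noncomputable section

variable {V : Type}

/-- Number of edges of the hypergraph `G` containing the vertex set `A`. -/
def degSet (G : Finset (Finset V)) (A : Finset V) : ℕ :=
  (G.filter fun e => A ⊆ e).card

/-- The neighborhood of an `(r-1)`-tuple `T`: vertices completing `T` to an edge. -/
def linkN [Fintype V] (G : Finset (Finset V)) (T : Finset V) : Finset V :=
  Finset.univ.filter fun v => v ∉ T ∧ insert v T ∈ G

/-- Common link `CN_G(S)`: the `(r-1)`-sets forming an edge with every vertex of `S`. -/
def CN (r : ℕ) [Fintype V] (G : Finset (Finset V)) (S : Finset V) : Finset (Finset V) :=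
  Finset.univ.filter fun T : Finset V =>
    T.card = r - 1 ∧ ∀ v ∈ S, v ∉ T ∧ insert v T ∈ G

/-- `cd_G(S|u)`: number of members of `CN_G(S)` containing `u`. -/
def cdOn (r : ℕ) [Fintype V] (G : Finset (Finset V)) (S : Finset V) (u : V) : ℕ :=
  ((CN r G S).filter fun T => u ∈ T).card

/-- `C` is a vertex cover of the set family `E`. -/
def IsVertexCover (C : Finset V) (E : Finset (Finset V)) : Prop :=
  ∀ T ∈ E, ∃ v ∈ C, v ∈ T

/-- `G` contains no copy of `K_{s,t}^{(r)}`. -/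
def KstFree (r s t : ℕ) (G : Finset (Finset V)) : Prop :=
  ¬ ∃ (X : Fin t → Finset V) (Y : Finset V),
      (∀ i, (X i).card = r - 1) ∧ Y.card = s ∧
      (∀ i j, i ≠ j → Disjoint (X i) (X j)) ∧
      (∀ i, Disjoint (X i) Y) ∧
      ∀ i, ∀ y ∈ Y, insert y (X i) ∈ G

/-- `G` is a balanced `r`-partite `r`-uniform hypergraph with parts `parts` of size `n`. -/
def IsPartite (r n : ℕ) (parts : Fin r → Finset V) (G : Finset (Finset V)) : Prop :=
  (∀ i j, i ≠ j → Disjoint (parts i) (parts j)) ∧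
  (∀ v : V, ∃ i, v ∈ parts i) ∧
  (∀ i, (parts i).card = n) ∧
  ∀ e ∈ G, ∀ i, (e ∩ parts i).card = 1

/-- `(ε, α)`-regularity in the sense of the paper. -/
def RegularHG (r s n : ℕ) (parts : Fin r → Finset V) (G : Finset (Finset V)) (ε α : ℝ) : Prop :=
  (n : ℝ) ^ ((r : ℝ) - 1 / ((s : ℝ) - 1) - ε) ≤ (G.card : ℝ) ∧
  ∀ i : Fin r, ∃ Δ : ℝ,
    (n : ℝ) ^ (1 - 1 / ((s : ℝ) - 1) - ε) ≤ Δ ∧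
    Δ ≤ (n : ℝ) ^ (1 - 1 / ((s : ℝ) - 1) + ε) ∧
    ∀ T : Finset V, T.card = r - 1 → Disjoint T (parts i) → 1 ≤ degSet G T →
      Δ / α ≤ (degSet G T : ℝ) ∧ (degSet G T : ℝ) ≤ Δ

/-- The pair `(T; v)` is `δ`-dense on `u` in `G`. -/
def DenseOn (r s n : ℕ) [Fintype V] (G : Finset (Finset V)) (T : Finset V) (v u : V)
    (δ : ℝ) : Prop :=
  (degSet G T : ℝ) ^ (s - 1) / (r : ℝ) ≤
    ((((linkN G T).powersetCard s).filter fun S =>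
      v ∈ S ∧ (n : ℝ) ^ ((r : ℝ) - 2 - 1 / ((s : ℝ) - 1) - δ) ≤ (cdOn r G S u : ℝ)).card : ℝ)

/-- The relation `V_i →_δ^{H,G} V_j`. -/
def Arrow (r s n : ℕ) [Fintype V] (parts : Fin r → Finset V) (H G : Finset (Finset V))
    (i j : Fin r) (δ : ℝ) : Prop :=
  ∀ T : Finset V, T.card = r - 1 → Disjoint T (parts j) → 1 ≤ degSet H T →
    ∀ v ∈ linkN H T, ∀ u ∈ T ∩ parts i, DenseOn r s n G T v u δ

/-- Every `r`-uniform hypergraph on `r * n` vertices admits a balanced partition of its vertex set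
into `r` parts for which at least a fraction `r ^ (-r)` of the edges is transversal. -/
lemma exists_balanced_partition {r n : ℕ} (hn : 0 < n) (V : Type) [Fintype V]
    (hV : Fintype.card V = r * n) (G : Finset (Finset V)) (hG : ∀ e ∈ G, e.card = r) :
    ∃ parts : Fin r → Finset V,
      (∀ i j, i ≠ j → Disjoint (parts i) (parts j)) ∧
      (∀ v : V, ∃ i, v ∈ parts i) ∧
      (∀ i, (parts i).card = n) ∧
      G.card ≤ r ^ r * (G.filter fun e => ∀ i, (e ∩ parts i).card = 1).card := by
  have φ : V ≃ Fin r × Fin n := Fintype.equivOfCardEq (by simp [hV])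
  let P : Equiv.Perm V → Fin r → Finset V := fun σ i => univ.filter fun v => (φ (σ v)).1 = i
  have hP (σ : Equiv.Perm V) (i : Fin r) (v : V) : v ∈ P σ i ↔ (φ (σ v)).1 = i := by simp [P]
  let good : Equiv.Perm V → Finset V → Prop := fun σ e => ∀ i, (e ∩ P σ i).card = 1
  let N : Finset V → ℕ := fun e => (univ.filter fun σ => good σ e).card
  have hgood (σ π : Equiv.Perm V) (e : Finset V) :
      good σ (e.map π.toEmbedding) ↔ good (σ * π) e := by
    refine forall_congr' fun i => ?_
    have : e.map π.toEmbedding ∩ P σ i = (e ∩ P (σ * π) i).map π.toEmbedding := by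
      ext v
      simp [mem_map_equiv, hP]
    rw [this, card_map]
  have hN (e e' : Finset V) (h : e.card = e'.card) : N e = N e' := by
    obtain ⟨π, hπ⟩ : ∃ π : Equiv.Perm V, e.map π.toEmbedding = e' := by
      let f : {x // x ∈ e} ≃ {x // x ∈ e'} := Finset.equivOfCardEq h
      refine ⟨f.extendSubtype, ?_⟩
      refine eq_of_subset_of_card_le ?_ (by simp [h])
      intro v hv
      obtain ⟨w, hw, rfl⟩ := mem_map.1 hv
      exact f.extendSubtype_mem w hw
    subst hπ
    refine (card_bij (fun σ _ => σ * π) ?_ ?_ ?_).symm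
    · intro σ hσ
      simpa [hgood] using hσ
    · intro a _ b _ hab
      exact mul_right_cancel hab
    · intro σ hσ
      refine ⟨σ * π⁻¹, ?_, by simp⟩
      simpa [hgood] using hσ
  have htrans (σ : Equiv.Perm V) : n ^ r ≤ ((powersetCard r univ).filter (good σ)).card := by
    let c : (Fin r → Fin n) → Fin r → V := fun g i => σ.symm (φ.symm (i, g i))
    have hc (g : Fin r → Fin n) (i : Fin r) : φ (σ (c g i)) = (i, g i) := by simp [c]
    have hcinj (g : Fin r → Fin n) : Function.Injective (c g) := by
      intro i j hij
      have h := hc g i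
      rw [hij, hc] at h
      exact (congrArg Prod.fst h).symm
    have hcard : n ^ r = (univ : Finset (Fin r → Fin n)).card := by simp
    rw [hcard]
    refine card_le_card_of_injOn (fun g => univ.image (c g)) ?_ ?_
    · intro g _
      refine mem_coe.2 (mem_filter.2 ⟨mem_powersetCard.2 ⟨subset_univ _, ?_⟩, fun i => ?_⟩)
      · rw [card_image_of_injective _ (hcinj g)]
        simp
      · refine card_eq_one.2 ⟨c g i, ?_⟩
        ext v
        simp only [mem_inter, mem_image, mem_univ, true_and, P, mem_filter, mem_singleton]
        constructor
        · rintro ⟨⟨j, rfl⟩, h⟩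
          rw [hc] at h
          exact congrArg (c g) h
        · rintro rfl
          exact ⟨⟨i, rfl⟩, by rw [hc]⟩
    · intro g _ g' _ h
      funext i
      have hmem : c g i ∈ univ.image (c g') := by
        rw [← (show univ.image (c g) = univ.image (c g') from h)]
        exact mem_image_of_mem _ (mem_univ _)
      obtain ⟨j, -, hj⟩ := mem_image.1 hmem
      have h1 := hc g' j
      rw [hj, hc] at h1
      have hij : i = j := congrArg Prod.fst h1
      have h2 : g i = g' j := congrArg Prod.snd h1
      rw [h2, hij]
  have hNe (e : Finset V) (he : e.card = r) :
      Fintype.card (Equiv.Perm V) ≤ r ^ r * N e := by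
    have h1 : ∑ e' ∈ powersetCard r (univ : Finset V), N e'
        = (r * n).choose r * N e := by
      rw [sum_congr rfl (g := fun _ => N e)
        (fun e' he' => hN e' e ((mem_powersetCard.1 he').2.trans he.symm))]
      simp [hV]
    have h2 : ∑ e' ∈ powersetCard r (univ : Finset V), N e'
        = ∑ σ : Equiv.Perm V, ((powersetCard r univ).filter (good σ)).card :=
      sum_card_bipartiteAbove_eq_sum_card_bipartiteBelow (fun e' σ => good σ e')
    have h3 : Fintype.card (Equiv.Perm V) * n ^ r
        ≤ ∑ σ : Equiv.Perm V, ((powersetCard r univ).filter (good σ)).card := by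
      have := card_nsmul_le_sum (univ : Finset (Equiv.Perm V)) _ (n ^ r) (fun σ _ => htrans σ)
      simpa only [smul_eq_mul, card_univ] using this
    have h4 : Fintype.card (Equiv.Perm V) * n ^ r ≤ (r ^ r * N e) * n ^ r := by
      calc _ ≤ (r * n).choose r * N e := by rw [← h1, h2]; exact h3
        _ ≤ (r * n) ^ r * N e := Nat.mul_le_mul_right _ (Nat.choose_le_pow _ _)
        _ = _ := by rw [mul_pow]; ring
    exact Nat.le_of_mul_le_mul_right h4 (pow_pos hn r)
  obtain ⟨σ, hσ⟩ : ∃ σ, G.card ≤ r ^ r * (G.filter (good σ)).card := by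
    by_contra! hcon
    have h1 : ∑ e ∈ G, N e = ∑ σ : Equiv.Perm V, (G.filter (good σ)).card :=
      sum_card_bipartiteAbove_eq_sum_card_bipartiteBelow (fun e' σ => good σ e')
    have h2 : G.card * Fintype.card (Equiv.Perm V) ≤ ∑ e ∈ G, r ^ r * N e := by
      have := card_nsmul_le_sum G _ _ (fun e he => hNe e (hG e he))
      simpa only [smul_eq_mul] using this
    rw [← mul_sum, h1, mul_sum] at h2
    have h3 : ∑ σ : Equiv.Perm V, r ^ r * (G.filter (good σ)).card
        < ∑ _σ : Equiv.Perm V, G.card :=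
      sum_lt_sum_of_nonempty univ_nonempty (fun σ _ => hcon σ)
    simp only [sum_const, card_univ, smul_eq_mul] at h3
    rw [mul_comm] at h3
    omega
  refine ⟨P σ, ?_, ?_, ?_, hσ⟩
  · intro i j hij
    refine disjoint_left.2 fun v hv hv' => hij ?_
    simp only [P, mem_filter, mem_univ, true_and] at hv hv'
    exact hv.symm.trans hv'
  · intro v
    exact ⟨(φ (σ v)).1, by simp [P]⟩
  · intro i
    have : P σ i = univ.map ((⟨fun a => (i, a), fun a b h => by simpa using h⟩ :
        Fin n ↪ Fin r × Fin n).trans (σ.trans φ).symm.toEmbedding) := by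
      ext v
      simp only [P, mem_filter, mem_univ, true_and, mem_map, Function.Embedding.trans_apply,
        Function.Embedding.coeFn_mk, Equiv.symm_apply_eq]
      constructor
      · intro h
        exact ⟨(φ (σ v)).2, by simp [← h]⟩
      · rintro ⟨a, h⟩
        have := congrArg Prod.fst h
        exact this.symm
    rw [this, card_map, card_univ, Fintype.card_fin]

/-- Dyadic regularization: a finite set `E` with projections `p i` has a large subset in which, for
each `i`, all nonempty fibers of `p i` have comparable sizes. -/
lemma exists_subset_regular_fibers {α β ι : Type*} [Fintype ι] [DecidableEq β]
    (E : Finset α) (p : ι → α → β)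
    (n : ℕ) (hE : ∀ i b, (E.filter fun e => p i e = b).card ≤ n) (θ : ℝ) (hθ : 0 ≤ θ) :
    ∃ H ⊆ E, ∃ k : ι → ℕ,
      (E.card : ℝ) / ((Nat.log 2 n : ℝ) + 1) ^ Fintype.card ι
        - Fintype.card ι * (θ * E.card) ≤ H.card ∧
      ∀ i, ∀ e ∈ H, θ * 2 ^ k i ≤ ((H.filter fun e' => p i e' = p i e).card : ℝ) ∧
        ((H.filter fun e' => p i e' = p i e).card : ℝ) ≤ 2 * 2 ^ k i := by
  let d : ι → β → ℕ := fun i b => (E.filter fun e => p i e = b).card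
  let c : α → ι → Fin (Nat.log 2 n + 1) := fun e i =>
    ⟨Nat.log 2 (d i (p i e)), Nat.lt_succ_of_le (Nat.log_mono_right (hE i _))⟩
  obtain ⟨k, -, hk⟩ : ∃ k ∈ (univ : Finset (ι → Fin (Nat.log 2 n + 1))),
      (E.card : ℝ) / ((Nat.log 2 n : ℝ) + 1) ^ Fintype.card ι
        ≤ ((E.filter fun e => c e = k).card : ℝ) := by
    refine exists_le_card_fiber_of_nsmul_le_card_of_maps_to (fun _ _ => mem_univ _)
      univ_nonempty ?_
    rw [nsmul_eq_mul, card_univ, Fintype.card_fun, Fintype.card_fin]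
    push_cast
    rw [mul_div_cancel₀]
    positivity
  set P := E.filter fun e => c e = k
  have hdP (i : ι) (e : α) (he : e ∈ P) :
      2 ^ (k i : ℕ) ≤ d i (p i e) ∧ d i (p i e) < 2 ^ ((k i : ℕ) + 1) := by
    obtain ⟨heE, hek⟩ := mem_filter.1 he
    have hki : Nat.log 2 (d i (p i e)) = k i := congrArg Fin.val (congrFun hek i)
    have hne : d i (p i e) ≠ 0 := by
      have : 0 < d i (p i e) := card_pos.2 ⟨e, mem_filter.2 ⟨heE, rfl⟩⟩
      omega
    rw [← hki]
    exact ⟨Nat.pow_log_le_self 2 hne, Nat.lt_pow_succ_log_self one_lt_two _⟩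
  let Φ : Finset α → ℝ := fun F => F.card - ∑ i, θ * 2 ^ (k i : ℕ) * ((F.image (p i)).card : ℝ)
  obtain ⟨H, hHP, hmax⟩ := exists_max_image P.powerset Φ ⟨P, mem_powerset_self P⟩
  rw [mem_powerset] at hHP
  refine ⟨H, hHP.trans (filter_subset _ _), fun i => k i, ?_, ?_⟩
  · have h1 := hmax P (mem_powerset_self P)
    have h2 : Φ H ≤ H.card := by
      refine sub_le_self _ (sum_nonneg fun i _ => by positivity)
    have h3 : ∑ i, θ * 2 ^ (k i : ℕ) * ((P.image (p i)).card : ℝ)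
        ≤ Fintype.card ι * (θ * E.card) := by
      have := sum_le_card_nsmul (univ : Finset ι)
        (fun i => θ * 2 ^ (k i : ℕ) * ((P.image (p i)).card : ℝ)) (θ * E.card) ?_
      · simpa only [nsmul_eq_mul, card_univ] using this
      · intro i _
        rw [mul_assoc]
        refine mul_le_mul_of_nonneg_left ?_ hθ
        have h4 : 2 ^ (k i : ℕ) * (P.image (p i)).card ≤ E.card := by
          have h5 : ∑ b ∈ P.image (p i), d i b ≤ E.card := by
            refine (sum_card_fiberwise_eq_card_filter _ _ _).trans_le (card_filter_le _ _)
          refine le_trans ?_ h5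
          rw [mul_comm, ← smul_eq_mul]
          refine card_nsmul_le_sum _ _ _ fun b hb => ?_
          obtain ⟨e, he, rfl⟩ := mem_image.1 hb
          exact (hdP i e he).1
        exact_mod_cast h4
    have h6 : Φ P = P.card - ∑ i, θ * 2 ^ (k i : ℕ) * ((P.image (p i)).card : ℝ) := rfl
    linarith
  · intro i e he
    constructor
    · let F := H.filter fun e' => p i e' ≠ p i e
      have hF : F ⊆ H := filter_subset _ _
      have h1 := hmax F (mem_powerset.2 (hF.trans hHP))
      have h2 : ((H.filter fun e' => p i e' = p i e).card : ℝ) + F.card = H.card := by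
        exact_mod_cast card_filter_add_card_filter_not (s := H) (fun e' => p i e' = p i e)
      have h3 : ∑ j, θ * 2 ^ (k j : ℕ) * ((F.image (p j)).card : ℝ) + θ * 2 ^ (k i : ℕ)
          ≤ ∑ j, θ * 2 ^ (k j : ℕ) * ((H.image (p j)).card : ℝ) := by
        rw [← add_sum_erase _ _ (mem_univ i), ← add_sum_erase _ _ (mem_univ i)]
        have h4 : ∑ j ∈ univ.erase i, θ * 2 ^ (k j : ℕ) * ((F.image (p j)).card : ℝ)
            ≤ ∑ j ∈ univ.erase i, θ * 2 ^ (k j : ℕ) * ((H.image (p j)).card : ℝ) := by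
          refine sum_le_sum fun j _ => mul_le_mul_of_nonneg_left ?_ (by positivity)
          exact_mod_cast card_le_card (image_subset_image hF)
        have h5 : ((F.image (p i)).card : ℝ) + 1 ≤ ((H.image (p i)).card : ℝ) := by
          have : (F.image (p i)).card < (H.image (p i)).card := by
            refine card_lt_card ((ssubset_iff_of_subset (image_subset_image hF)).2
              ⟨p i e, mem_image_of_mem _ he, ?_⟩)
            intro hmem
            obtain ⟨e', he', h⟩ := mem_image.1 hmem
            exact (mem_filter.1 he').2 h
          exact_mod_cast this
        have h6 : θ * 2 ^ (k i : ℕ) * (((F.image (p i)).card : ℝ) + 1)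
            ≤ θ * 2 ^ (k i : ℕ) * ((H.image (p i)).card : ℝ) :=
          mul_le_mul_of_nonneg_left h5 (by positivity)
        linarith
      simp only [Φ] at h1
      linarith
    · have h1 : (H.filter fun e' => p i e' = p i e).card ≤ d i (p i e) :=
        card_le_card (filter_subset_filter _ (hHP.trans (filter_subset _ _)))
      have h2 := (hdP i e (hHP he)).2
      rw [pow_succ] at h2
      have h3 : (H.filter fun e' => p i e' = p i e).card ≤ 2 * 2 ^ (k i : ℕ) := by omega
      exact_mod_cast h3

/-- If an edge is determined up to `D` choices by its intersections with the parts indexed by `J`,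
then there are at most `D * n ^ |J|` edges. -/
lemma card_le_of_determined_by_parts {r n : ℕ} {parts : Fin r → Finset V}
    (hcard : ∀ i, (parts i).card = n) (F : Finset (Finset V))
    (hF : ∀ e ∈ F, ∀ i, (e ∩ parts i).card = 1) (J : Finset (Fin r)) (D : ℕ)
    (hD : ∀ e ∈ F, (F.filter fun e' => ∀ i ∈ J, e' ∩ parts i = e ∩ parts i).card ≤ D) :
    F.card ≤ D * n ^ J.card := by
  have h : F.card ≤ D * (Fintype.piFinset fun i : J => powersetCard 1 (parts i)).card := by
    refine card_le_mul_card_image_of_maps_to (f := fun e (i : J) => e ∩ parts i) ?_ D ?_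
    · intro e he
      exact Fintype.mem_piFinset.2 fun i =>
        mem_powersetCard.2 ⟨inter_subset_right, hF e he i⟩
    · intro b _
      rcases (F.filter fun e => (fun i : J => e ∩ parts i) = b).eq_empty_or_nonempty with h | ⟨e, he⟩
      · rw [h]
        simp
      · obtain ⟨heF, rfl⟩ := mem_filter.1 he
        refine (card_le_card ?_).trans (hD e heF)
        refine monotone_filter_right _ fun e' _ h' i hi => ?_
        exact congrFun h' ⟨i, hi⟩
  simpa [Fintype.card_piFinset, hcard] using h

/-- A family of nonempty `m`-sets without `t` pairwise disjoint members has a vertex cover of size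
at most `t * m`. -/
lemma exists_isVertexCover_of_no_matching (m t : ℕ) (hm : 0 < m) (F : Finset (Finset V))
    (hF : ∀ T ∈ F, T.card = m)
    (hfree : ¬ ∃ X : Fin t → Finset V, (∀ i, X i ∈ F) ∧ ∀ i j, i ≠ j → Disjoint (X i) (X j)) :
    ∃ C : Finset V, C.card ≤ t * m ∧ IsVertexCover C F := by
  let 𝓜 : Finset (Finset (Finset V)) := F.powerset.filter fun M =>
    (M : Set (Finset V)).PairwiseDisjoint id
  obtain ⟨M, hM, hmax⟩ := exists_max_image 𝓜 card
    ⟨∅, mem_filter.2 ⟨empty_mem_powerset _, by simp⟩⟩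
  obtain ⟨hMF, hdisj⟩ := mem_filter.1 hM
  rw [mem_powerset] at hMF
  refine ⟨M.biUnion id, ?_, ?_⟩
  · have hMt : M.card ≤ t := by
      by_contra! hlt
      obtain ⟨f⟩ : Nonempty (Fin t ↪ M) :=
        Function.Embedding.nonempty_of_card_le (by simpa using hlt.le)
      refine hfree ⟨fun i => f i, fun i => hMF (f i).2, fun i j hij => ?_⟩
      exact hdisj (f i).2 (f j).2 fun h => hij (f.injective (Subtype.ext h))
    exact (card_biUnion_le_card_mul _ _ m fun T hT => (hF T (hMF hT)).le).trans
      (Nat.mul_le_mul_right _ hMt)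
  · intro T hT
    by_contra! hcon
    have hTdisj (T' : Finset V) (hT' : T' ∈ M) : Disjoint T T' := by
      refine disjoint_left.2 fun v hv hv' => ?_
      exact hcon v (mem_biUnion.2 ⟨T', hT', hv'⟩) hv
    have hTM : T ∉ M := by
      intro h
      have h0 : T = ∅ := disjoint_self.1 (hTdisj T h)
      have := hF T hT
      rw [h0, card_empty] at this
      omega
    have h1 := hmax (insert T M) (mem_filter.2 ⟨mem_powerset.2 (insert_subset hT hMF), by
      rw [coe_insert]
      exact hdisj.insert fun T' hT' _ => hTdisj T' hT'⟩)
    rw [card_insert_of_notMem hTM] at h1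
    omega

lemma card_sdiff_part {r : ℕ} {parts : Fin r → Finset V} {e : Finset V} (he : e.card = r)
    {i : Fin r} (hei : (e ∩ parts i).card = 1) : (e \ parts i).card = r - 1 := by
  have := card_sdiff_add_card_inter e (parts i)
  omega

lemma degSet_eq_card_fiber {r : ℕ} {parts : Fin r → Finset V} {H : Finset (Finset V)}
    (hH : ∀ e ∈ H, e.card = r) (hpart : ∀ e ∈ H, ∀ i, (e ∩ parts i).card = 1) (i : Fin r)
    {T : Finset V} (hT : T.card = r - 1) (hdisj : Disjoint T (parts i)) :
    degSet H T = (H.filter fun e => e \ parts i = T).card := by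
  unfold degSet
  congr 1
  refine filter_congr fun e he => ⟨fun h => ?_, ?_⟩
  · refine (eq_of_subset_of_card_le (subset_sdiff.2 ⟨h, hdisj⟩) ?_).symm
    rw [card_sdiff_part (hH e he) (hpart e he i), hT]
  · rintro rfl
    exact sdiff_subset

/-- In a balanced `r`-partite hypergraph where all `(r - 1)`-tuples have degree at most `D`, two
vertices from different parts lie in at most `D * n ^ (r - 3)` common edges. -/
lemma card_filter_mem_mem_le {r n D : ℕ} (hr : 3 ≤ r) {parts : Fin r → Finset V}
    (hcov : ∀ v : V, ∃ i, v ∈ parts i) (hcard : ∀ i, (parts i).card = n)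
    {H : Finset (Finset V)} (hpart : ∀ e ∈ H, ∀ i, (e ∩ parts i).card = 1)
    (hD : ∀ i T, (H.filter fun e => e \ parts i = T).card ≤ D)
    {i j : Fin r} (hij : i ≠ j) {u v : V} (hv : v ∈ parts i) (hu : u ∈ parts j) :
    (H.filter fun e => u ∈ e ∧ v ∈ e).card ≤ D * n ^ (r - 3) := by
  obtain ⟨k, hk⟩ : ∃ k, k ∉ ({i, j} : Finset (Fin r)) := by
    by_contra! h
    have h1 : (univ : Finset (Fin r)) ⊆ {i, j} := fun k _ => h k
    have h2 := card_le_card h1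
    have h3 := card_le_two (a := i) (b := j)
    simp only [card_univ, Fintype.card_fin] at h2
    omega
  have hJ : ({k, i, j} : Finset (Fin r))ᶜ.card = r - 3 := by
    rw [card_compl, Fintype.card_fin, card_insert_of_notMem hk, card_pair hij]
  rw [← hJ]
  refine card_le_of_determined_by_parts hcard _
    (fun e he => hpart e (mem_filter.1 he).1) _ D fun e he => ?_
  refine (card_le_card fun e' he' => ?_).trans (hD k (e \ parts k))
  obtain ⟨he'1, hJe⟩ := mem_filter.1 he'
  obtain ⟨he'H, hu', hv'⟩ := mem_filter.1 he'1
  obtain ⟨heH, hue, hve⟩ := mem_filter.1 he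
  have hsingle {x : V} {l : Fin r} (hx : x ∈ parts l) (hxe : x ∈ e) (hxe' : x ∈ e') :
      e' ∩ parts l = e ∩ parts l := by
    obtain ⟨a, ha⟩ := card_eq_one.1 (hpart e heH l)
    obtain ⟨b, hb⟩ := card_eq_one.1 (hpart e' he'H l)
    have h1 : x ∈ e ∩ parts l := mem_inter.2 ⟨hxe, hx⟩
    have h2 : x ∈ e' ∩ parts l := mem_inter.2 ⟨hxe', hx⟩
    rw [ha, mem_singleton] at h1
    rw [hb, mem_singleton] at h2
    rw [ha, hb, ← h1, ← h2]
  have hall (l : Fin r) (hl : l ≠ k) : e' ∩ parts l = e ∩ parts l := by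
    by_cases hli : l = i
    · subst hli
      exact hsingle hv hve hv'
    by_cases hlj : l = j
    · subst hlj
      exact hsingle hu hue hu'
    exact hJe l (by simp [hl, hli, hlj])
  refine mem_filter.2 ⟨he'H, ?_⟩
  ext x
  obtain ⟨l, hl⟩ := hcov x
  by_cases hlk : l = k
  · subst hlk
    simp [hl]
  · have h := congrArg (x ∈ ·) (hall l hlk)
    simp only [mem_inter, hl, and_true, eq_iff_iff] at h
    simp only [mem_sdiff, h]

/-- The set of `(r - 1)`-tuples avoiding part `i` and joined to every vertex of an `s`-subset of
part `i` is small in a `K_{s,t}`-free hypergraph. -/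
lemma card_common_link_le {r s t n D : ℕ} (hr : 3 ≤ r) (hs : 1 ≤ s) {parts : Fin r → Finset V}
    (hcov : ∀ v : V, ∃ i, v ∈ parts i) (hcard : ∀ i, (parts i).card = n)
    {H : Finset (Finset V)} (hH : ∀ e ∈ H, e.card = r)
    (hpart : ∀ e ∈ H, ∀ i, (e ∩ parts i).card = 1) (hfree : KstFree r s t H)
    (hD : ∀ i T, (H.filter fun e => e \ parts i = T).card ≤ D)
    (i : Fin r) {S : Finset V} (hS : S ⊆ parts i) (hSs : S.card = s) :
    ((H.image fun e => e \ parts i).filter fun T => ∀ v ∈ S, insert v T ∈ H).card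
      ≤ t * (r - 1) * (D * n ^ (r - 3)) := by
  set F := (H.image fun e => e \ parts i).filter fun T => ∀ v ∈ S, insert v T ∈ H
  have hF (T : Finset V) (hT : T ∈ F) :
      T.card = r - 1 ∧ Disjoint T (parts i) ∧ ∀ v ∈ S, insert v T ∈ H := by
    obtain ⟨hT1, hT2⟩ := mem_filter.1 hT
    obtain ⟨e, he, rfl⟩ := mem_image.1 hT1
    exact ⟨card_sdiff_part (hH e he) (hpart e he i), sdiff_disjoint, hT2⟩
  obtain ⟨C, hC, hcover⟩ := exists_isVertexCover_of_no_matching (r - 1) t (by omega) F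
    (fun T hT => (hF T hT).1) (by
      rintro ⟨X, hX, hXdisj⟩
      exact hfree ⟨X, S, fun l => (hF _ (hX l)).1, hSs, hXdisj,
        fun l => (hF _ (hX l)).2.1.mono_right hS, fun l => (hF _ (hX l)).2.2⟩)
  obtain ⟨v, hv⟩ : S.Nonempty := card_pos.1 (by omega)
  have hFC : F ⊆ C.biUnion fun u => F.filter fun T => u ∈ T := by
    intro T hT
    obtain ⟨u, hu, huT⟩ := hcover T hT
    exact mem_biUnion.2 ⟨u, hu, mem_filter.2 ⟨hT, huT⟩⟩
  refine (card_le_card hFC).trans ((card_biUnion_le_card_mul _ _ (D * n ^ (r - 3)) ?_).trans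
    (Nat.mul_le_mul_right _ hC))
  intro u _
  rcases (F.filter fun T => u ∈ T).eq_empty_or_nonempty with h0 | ⟨T₀, hT₀⟩
  · rw [h0]
    simp
  obtain ⟨hT₀F, huT₀⟩ := mem_filter.1 hT₀
  obtain ⟨j, hj⟩ := hcov u
  have hij : i ≠ j := by
    rintro rfl
    exact disjoint_left.1 (hF _ hT₀F).2.1 huT₀ hj
  refine le_trans ?_ (card_filter_mem_mem_le hr hcov hcard hpart hD hij (hS hv) hj)
  refine card_le_card_of_injOn (fun T => insert v T) ?_ ?_
  · intro T hT
    obtain ⟨hTF, huT⟩ := mem_filter.1 (mem_coe.1 hT)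
    exact mem_coe.2 (mem_filter.2 ⟨(hF T hTF).2.2 v hv, mem_insert_of_mem huT,
      mem_insert_self _ _⟩)
  · intro T hT T' hT' h
    have hnot (A : Finset V) (hA : A ∈ F.filter fun T => u ∈ T) : v ∉ A := fun hvA =>
      disjoint_left.1 (hF A (mem_filter.1 hA).1).2.1 hvA (hS hv)
    have h2 := congrArg (fun A => A.erase v) h
    simpa [erase_insert (hnot T hT), erase_insert (hnot T' hT')] using h2

/-- Double counting of pairs consisting of an `(r - 1)`-tuple avoiding part `i` and an `s`-subset of
its neighborhood. -/
lemma sum_choose_degree_le {r s t n D : ℕ} (hr : 3 ≤ r) (hs : 1 ≤ s) {parts : Fin r → Finset V}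
    (hcov : ∀ v : V, ∃ i, v ∈ parts i) (hcard : ∀ i, (parts i).card = n)
    {H : Finset (Finset V)} (hH : ∀ e ∈ H, e.card = r)
    (hpart : ∀ e ∈ H, ∀ i, (e ∩ parts i).card = 1) (hfree : KstFree r s t H)
    (hD : ∀ i T, (H.filter fun e => e \ parts i = T).card ≤ D) (i : Fin r) :
    ∑ T ∈ H.image (fun e => e \ parts i), (H.filter fun e => e \ parts i = T).card.choose s
      ≤ n ^ s * (t * (r - 1) * (D * n ^ (r - 3))) := by
  set 𝒯 := H.image fun e => e \ parts i
  have h1 (T : Finset V) (hT : T ∈ 𝒯) : (H.filter fun e => e \ parts i = T).card.choose s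
      ≤ ((powersetCard s (parts i)).filter fun S => ∀ v ∈ S, insert v T ∈ H).card := by
    have h2 : (H.filter fun e => e \ parts i = T).card
        ≤ ((parts i).filter fun v => insert v T ∈ H).card := by
      refine card_le_card_of_surjOn (fun v => insert v T) ?_
      intro e he
      obtain ⟨heH, heT⟩ := mem_filter.1 (mem_coe.1 he)
      obtain ⟨v, hv⟩ := card_eq_one.1 (hpart e heH i)
      have hins : insert v T = e := by
        rw [← heT, insert_eq, ← hv, union_comm, sdiff_union_inter]
      have hvp : v ∈ e ∩ parts i := by
        rw [hv]
        exact mem_singleton_self v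
      exact ⟨v, mem_coe.2 (mem_filter.2 ⟨(mem_inter.1 hvp).2, by rwa [hins]⟩), hins⟩
    refine (Nat.choose_le_choose s h2).trans ?_
    rw [← card_powersetCard]
    refine card_le_card fun S hS => ?_
    obtain ⟨hS1, hS2⟩ := mem_powersetCard.1 hS
    exact mem_filter.2 ⟨mem_powersetCard.2 ⟨hS1.trans (filter_subset _ _), hS2⟩,
      fun v hv => (mem_filter.1 (hS1 hv)).2⟩
  refine (sum_le_sum h1).trans ?_
  have h3 : ∑ T ∈ 𝒯, ((powersetCard s (parts i)).filter fun S => ∀ v ∈ S, insert v T ∈ H).card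
      = ∑ S ∈ powersetCard s (parts i), (𝒯.filter fun T => ∀ v ∈ S, insert v T ∈ H).card :=
    sum_card_bipartiteAbove_eq_sum_card_bipartiteBelow fun T S => ∀ v ∈ S, insert v T ∈ H
  rw [h3]
  refine (sum_le_card_nsmul _ _ (t * (r - 1) * (D * n ^ (r - 3))) fun S hS => ?_).trans ?_
  · obtain ⟨hS1, hS2⟩ := mem_powersetCard.1 hS
    exact card_common_link_le hr hs hcov hcard hH hpart hfree hD i hS1 hS2
  · rw [smul_eq_mul, card_powersetCard, hcard]
    exact Nat.mul_le_mul_right _ (Nat.choose_le_pow _ _)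

/-- In a `K_{s,t}`-free balanced `r`-partite hypergraph whose maximum `(r - 1)`-degree `D` is
comparable to all degrees of tuples avoiding part `i`, the degree `D` is small. -/
lemma card_mul_pow_degree_le {r s t n D : ℕ} (hr : 3 ≤ r) (hs : 3 ≤ s) {parts : Fin r → Finset V}
    (hcov : ∀ v : V, ∃ i, v ∈ parts i) (hcard : ∀ i, (parts i).card = n)
    {H : Finset (Finset V)} (hH : ∀ e ∈ H, e.card = r)
    (hpart : ∀ e ∈ H, ∀ i, (e ∩ parts i).card = 1) (hfree : KstFree r s t H)
    (hD : ∀ i T, (H.filter fun e => e \ parts i = T).card ≤ D) (i : Fin r)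
    {α : ℝ} (hα : 0 < α)
    (hlow : ∀ e ∈ H, (D : ℝ) ≤ α * (H.filter fun e' => e' \ parts i = e \ parts i).card)
    (hlarge : 2 * α * s ≤ D) :
    (H.card : ℝ) * (D : ℝ) ^ (s - 2) ≤ (2 * α * s) ^ s * (t * r) * (n : ℝ) ^ (s + r - 3) := by
  have hs0 : (0 : ℝ) < s := by positivity
  have hD0 : (0 : ℝ) < D := lt_of_lt_of_le (by positivity) hlarge
  have hsum := sum_choose_degree_le hr (by omega) hcov hcard hH hpart hfree hD i
  set 𝒯 := H.image fun e => e \ parts i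
  have h1 (T : Finset V) (hT : T ∈ 𝒯) : ((D : ℝ) / (2 * α * s)) ^ s
      ≤ ((H.filter fun e => e \ parts i = T).card.choose s : ℕ) := by
    obtain ⟨e, he, rfl⟩ := mem_image.1 hT
    have h2 := hlow e he
    set d := (H.filter fun e' => e' \ parts i = e \ parts i).card
    have h3 : (2 * s : ℝ) ≤ d := by
      refine le_of_mul_le_mul_left ?_ hα
      linarith
    have h3' : 2 * s ≤ d := by exact_mod_cast h3
    have h4 : (D : ℝ) / (2 * α) ≤ ((d + 1 - s : ℕ) : ℝ) := by
      rw [Nat.cast_sub (by omega), div_le_iff₀ (by positivity)]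
      push_cast
      nlinarith
    have h5 : ((d + 1 - s : ℕ) : ℝ) ^ s / (Nat.factorial s : ℝ) ≤ (d.choose s : ℝ) :=
      Nat.pow_le_choose s d
    have h6 : (Nat.factorial s : ℝ) ≤ (s : ℝ) ^ s := by exact_mod_cast Nat.factorial_le_pow s
    calc ((D : ℝ) / (2 * α * s)) ^ s = ((D : ℝ) / (2 * α)) ^ s / (s : ℝ) ^ s := by
          rw [← div_pow, div_div]
      _ ≤ ((d + 1 - s : ℕ) : ℝ) ^ s / (Nat.factorial s : ℝ) := by gcongr
      _ ≤ _ := h5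
  have h2 : (𝒯.card : ℝ) * ((D : ℝ) / (2 * α * s)) ^ s
      ≤ n ^ s * (t * r * (D * n ^ (r - 3))) := by
    have h3 := card_nsmul_le_sum 𝒯 _ _ h1
    rw [nsmul_eq_mul, ← Nat.cast_sum] at h3
    have h4 : n ^ s * (t * (r - 1) * (D * n ^ (r - 3))) ≤ n ^ s * (t * r * (D * n ^ (r - 3))) := by
      gcongr
      exact Nat.sub_le _ _
    exact h3.trans (by exact_mod_cast hsum.trans h4)
  have h3 : (H.card : ℝ) ≤ D * 𝒯.card := by
    exact_mod_cast card_le_mul_card_image H D fun T _ => hD i T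
  rw [div_pow, ← mul_div_assoc, div_le_iff₀ (by positivity)] at h2
  have hsr : s + r - 3 = s + (r - 3) := by omega
  have hDs : (D : ℝ) ^ s = (D : ℝ) ^ (s - 2) * D ^ 2 := by
    rw [← pow_add]
    congr 1
    omega
  have h4 : (H.card : ℝ) * (D : ℝ) ^ s ≤ D * (𝒯.card * (D : ℝ) ^ s) := by
    rw [← mul_assoc]
    gcongr
  have h5 := h4.trans (mul_le_mul_of_nonneg_left h2 hD0.le)
  rw [hDs] at h5
  refine le_of_mul_le_mul_right ?_ (pow_pos hD0 2)
  rw [hsr, pow_add]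
  linarith

lemma eventually_const_mul_pow_le_two_rpow_sqrt (K : ℝ) (m : ℕ) :
    ∀ᶠ x : ℝ in Filter.atTop, K * x ^ m ≤ (2 : ℝ) ^ √x := by
  have h := isLittleO_pow_exp_pos_mul_atTop (2 * m) (Real.log_pos one_lt_two)
  have h1 := h.bound (c := 1 / (|K| + 1)) (by positivity)
  filter_upwards [Real.tendsto_sqrt_atTop.eventually h1, Filter.eventually_ge_atTop 0] with x hx hx0
  rw [pow_mul, Real.sq_sqrt hx0, Real.norm_of_nonneg (by positivity),
    Real.norm_of_nonneg (by positivity), one_div, ← div_eq_inv_mul, le_div_iff₀ (by positivity),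
    ← Real.rpow_def_of_pos two_pos] at hx
  have h2 : K * x ^ m ≤ (|K| + 1) * x ^ m := by
    gcongr
    linarith [le_abs_self K]
  linarith

lemma eventually_add_one_pow_le (r : ℕ) :
    ∀ᶠ x : ℝ in Filter.atTop, 3 * (x + 1) ^ r ≤ 4 * x ^ r := by
  have h : Filter.Tendsto (fun x : ℝ => (1 + x⁻¹) ^ r) Filter.atTop (nhds ((1 + 0) ^ r)) :=
    (tendsto_const_nhds.add tendsto_inv_atTop_zero).pow r
  have h1 := h.eventually_le_const (show ((1 : ℝ) + 0) ^ r < 4 / 3 by norm_num)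
  filter_upwards [h1, Filter.eventually_gt_atTop 0] with x hx hx0
  have h2 : (x + 1) ^ r = (1 + x⁻¹) ^ r * x ^ r := by
    rw [← mul_pow, add_mul, inv_mul_cancel₀ hx0.ne']
    ring
  rw [h2]
  nlinarith [pow_pos hx0 r]

lemma rpow_inv_sqrt_logb {n : ℝ} (hn : 0 < n) :
    n ^ (1 / √(Real.logb 2 n)) = (2 : ℝ) ^ √(Real.logb 2 n) := by
  conv_lhs => rw [← Real.rpow_logb two_pos (by norm_num) hn]
  rw [← Real.rpow_mul two_pos.le]
  congr 1
  rw [Real.rpow_logb two_pos (by norm_num) hn, mul_one_div, Real.div_sqrt]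

/-- Degrees in a `K_{s,t}`-free balanced `r`-partite hypergraph which has many edges and comparable
degrees are close to `n ^ (1 - 1 / (s - 1))`. -/
lemma regularHG_of_comparable_degrees {r s t n : ℕ} (hr : 3 ≤ r) (hs : 3 ≤ s) (ht : 1 ≤ t)
    (hn : 1 ≤ n) {parts : Fin r → Finset V}
    (hcov : ∀ v : V, ∃ i, v ∈ parts i) (hcard : ∀ i, (parts i).card = n)
    {H : Finset (Finset V)} (hH : ∀ e ∈ H, e.card = r)
    (hpart : ∀ e ∈ H, ∀ i, (e ∩ parts i).card = 1) (hfree : KstFree r s t H)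
    {α Q ε η : ℝ} (hα : 1 ≤ α) (hQ : 1 ≤ Q) (hε : 0 < ε) (hη : 0 ≤ η)
    (hcomp : ∀ i, ∀ e ∈ H, ∀ f ∈ H,
      ((H.filter fun e' => e' \ parts i = e \ parts i).card : ℝ)
        ≤ α * (H.filter fun e' => e' \ parts i = f \ parts i).card)
    (hHQ : (n : ℝ) ^ ((r : ℝ) - 1 / ((s : ℝ) - 1) - ε) ≤ Q * H.card)
    (hηQ : Q * ((2 * α * s) ^ s * (t * r)) ≤ (n : ℝ) ^ η) :
    RegularHG r s n parts H (ε + η) α := by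
  have hn0 : (0 : ℝ) < n := by exact_mod_cast hn
  have hn1 : (1 : ℝ) ≤ n := by exact_mod_cast hn
  have hs3 : (3 : ℝ) ≤ s := by exact_mod_cast hs
  have ht1 : (1 : ℝ) ≤ t := by exact_mod_cast ht
  have hr3 : (3 : ℝ) ≤ r := by exact_mod_cast hr
  have htr : (1 : ℝ) ≤ t * r := by nlinarith
  have hW : 1 ≤ 2 * α * s := by nlinarith
  have hWs : 2 * α * s ≤ (2 * α * s) ^ s := le_self_pow₀ hW (by omega)
  have hQN : Q ≤ (n : ℝ) ^ η := by
    refine le_trans (le_mul_of_one_le_right (by linarith) ?_) hηQ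
    nlinarith
  have hWN : 2 * α * s ≤ (n : ℝ) ^ η := by
    refine le_trans ?_ hηQ
    have : 2 * α * s ≤ (2 * α * s) ^ s * (t * r) :=
      hWs.trans (le_mul_of_one_le_right (by linarith) htr)
    exact this.trans (le_mul_of_one_le_left (by linarith) hQ)
  have hedges : (n : ℝ) ^ ((r : ℝ) - 1 / ((s : ℝ) - 1) - (ε + η)) ≤ H.card := by
    have h1 : (r : ℝ) - 1 / ((s : ℝ) - 1) - (ε + η) = ((r : ℝ) - 1 / ((s : ℝ) - 1) - ε) - η := by
      ring
    rw [h1, Real.rpow_sub hn0, div_le_iff₀ (by positivity), mul_comm]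
    exact hHQ.trans (by gcongr)
  have hHpos : 0 < H.card := by
    have h1 : (0 : ℝ) < H.card := lt_of_lt_of_le (by positivity) hedges
    exact_mod_cast h1
  have hHne : H.Nonempty := card_pos.1 hHpos
  let d : Fin r → Finset V → ℕ := fun i e => (H.filter fun e' => e' \ parts i = e \ parts i).card
  choose m hmH hmmax using fun i : Fin r => exists_max_image H (d i) hHne
  obtain ⟨i₀, -, hi₀⟩ := exists_max_image (univ : Finset (Fin r)) (fun i => d i (m i))
    ⟨⟨0, by omega⟩, mem_univ _⟩
  have hfib (i : Fin r) (T : Finset V) :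
      (H.filter fun e => e \ parts i = T).card ≤ d i (m i) := by
    rcases (H.filter fun e => e \ parts i = T).eq_empty_or_nonempty with h | ⟨e, he⟩
    · rw [h]
      simp
    · obtain ⟨heH, rfl⟩ := mem_filter.1 he
      exact hmmax i e heH
  set B : ℝ := 1 - 1 / ((s : ℝ) - 1) + (ε + η) with hB
  have hinv : 1 / ((s : ℝ) - 1) ≤ 1 := by
    rw [div_le_one (by linarith)]
    linarith
  have hupper : (d i₀ (m i₀) : ℝ) ≤ (n : ℝ) ^ B := by
    rcases lt_or_ge (d i₀ (m i₀) : ℝ) (2 * α * s) with hlt | hge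
    · refine (hlt.le.trans hWN).trans (Real.rpow_le_rpow_of_exponent_le hn1 ?_)
      linarith
    · have h1 := card_mul_pow_degree_le hr hs hcov hcard hH hpart hfree
        (fun i T => (hfib i T).trans (hi₀ i (mem_univ i))) i₀ (by linarith)
        (fun e he => hcomp i₀ _ (hmH i₀) e he) hge
      set D : ℝ := (d i₀ (m i₀) : ℝ)
      have h2 : (n : ℝ) ^ ((r : ℝ) - 1 / ((s : ℝ) - 1) - ε) * D ^ (s - 2)
          ≤ (n : ℝ) ^ η * (n : ℝ) ^ (s + r - 3) := by
        calc _ ≤ Q * H.card * D ^ (s - 2) := by gcongr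
          _ = Q * (H.card * D ^ (s - 2)) := by ring
          _ ≤ Q * ((2 * α * s) ^ s * (t * r) * (n : ℝ) ^ (s + r - 3)) := by gcongr
          _ = Q * ((2 * α * s) ^ s * (t * r)) * (n : ℝ) ^ (s + r - 3) := by ring
          _ ≤ _ := by gcongr
      have hcast : ((s + r - 3 : ℕ) : ℝ) = s + r - 3 := by
        rw [Nat.cast_sub (by omega)]
        push_cast
        ring
      have hcast2 : ((s - 2 : ℕ) : ℝ) = s - 2 := by
        rw [Nat.cast_sub (by omega)]
        push_cast
        ring
      rw [← Real.rpow_natCast (n : ℝ) (s + r - 3), ← Real.rpow_add hn0, mul_comm,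
        ← le_div_iff₀ (by positivity), ← Real.rpow_sub hn0, hcast] at h2
      have h3 : D ^ (s - 2) ≤ ((n : ℝ) ^ B) ^ (s - 2) := by
        refine h2.trans ?_
        rw [← Real.rpow_natCast ((n : ℝ) ^ B), ← Real.rpow_mul hn0.le, hcast2]
        refine Real.rpow_le_rpow_of_exponent_le hn1 ?_
        have h4 : B * (s - 2) - (η + (s + r - 3) - ((r : ℝ) - 1 / ((s : ℝ) - 1) - ε))
            = (s - 3) * (ε + η) := by
          rw [hB]
          have : (s : ℝ) - 1 ≠ 0 := by linarith
          field_simp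
          ring
        nlinarith [mul_nonneg (sub_nonneg.2 hs3) (by linarith : 0 ≤ ε + η)]
      exact le_of_pow_le_pow_left₀ (by omega) (by positivity) h3
  refine ⟨hedges, fun i => ⟨d i (m i), ?_, ?_, ?_⟩⟩
  · have h1 : H.card ≤ d i (m i) * n ^ (r - 1) := by
      have hJ : ({i} : Finset (Fin r))ᶜ.card = r - 1 := by
        rw [card_compl, Fintype.card_fin, card_singleton]
      rw [← hJ]
      refine card_le_of_determined_by_parts hcard H hpart _ _ fun e he => ?_
      refine (card_le_card ?_).trans (hfib i (e \ parts i))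
      refine monotone_filter_right _ fun e' _ h' => ?_
      ext x
      obtain ⟨l, hl⟩ := hcov x
      by_cases hli : l = i
      · subst hli
        simp [hl]
      · have h := congrArg (x ∈ ·) (h' l (by simpa using hli))
        simp only [mem_inter, hl, and_true, eq_iff_iff] at h
        simp only [mem_sdiff, h]
    have h2 : (H.card : ℝ) ≤ d i (m i) * (n : ℝ) ^ (r - 1) := by exact_mod_cast h1
    have hcast : ((r - 1 : ℕ) : ℝ) = r - 1 := by
      rw [Nat.cast_sub (by omega)]
      simp
    have h3 := hedges.trans h2
    rw [← div_le_iff₀ (by positivity), ← Real.rpow_natCast, ← Real.rpow_sub hn0, hcast] at h3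
    have h4 : 1 - 1 / ((s : ℝ) - 1) - (ε + η)
        = (r : ℝ) - 1 / ((s : ℝ) - 1) - (ε + η) - (r - 1) := by
      ring
    rwa [h4]
  · refine le_trans ?_ hupper
    exact_mod_cast hi₀ i (mem_univ i)
  · intro T hT hdisj hdeg
    rw [degSet_eq_card_fiber hH hpart i hT hdisj] at hdeg ⊢
    obtain ⟨e, he⟩ := card_pos.1 hdeg
    obtain ⟨heH, rfl⟩ := mem_filter.1 he
    refine ⟨?_, by exact_mod_cast hmmax i e heH⟩
    rw [div_le_iff₀ (by linarith), mul_comm]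
    exact hcomp i _ (hmH i) e heH

lemma KstFree.mono {r s t : ℕ} {G H : Finset (Finset V)} (hG : KstFree r s t G) (hHG : H ⊆ G) :
    KstFree r s t H := fun ⟨X, Y, h1, h2, h3, h4, h5⟩ =>
  hG ⟨X, Y, h1, h2, h3, h4, fun i y hy => hHG (h5 i y hy)⟩

theorem stmt_9 (r s t : ℕ) (hr : 3 ≤ r) (hs : 3 ≤ s) (ht : 1 ≤ t) (ε : ℝ) (hε : 0 < ε) :
    ∃ n₀ : ℕ, ∀ n ≥ n₀, ∀ (V : Type) [Fintype V], Fintype.card V = r * n →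
      ∀ G : Finset (Finset V), (∀ e ∈ G, e.card = r) → KstFree r s t G →
        (n : ℝ) ^ ((r : ℝ) - 1 / ((s : ℝ) - 1) - ε) ≤ (G.card : ℝ) →
        ∃ H ⊆ G, ∃ parts : Fin r → Finset V,
          IsPartite r n parts H ∧
          RegularHG r s n parts H (ε + 1 / Real.sqrt (Real.logb 2 (n : ℝ)))
            (4 * (r : ℝ) * (Real.logb 2 (n : ℝ)) ^ r) := by
  have hlog : Filter.Tendsto (fun n : ℕ => Real.logb 2 (n : ℝ)) Filter.atTop Filter.atTop :=
    (Real.tendsto_logb_atTop one_lt_two).comp tendsto_natCast_atTop_atTop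
  have hev := hlog.eventually ((Filter.eventually_ge_atTop 1).and ((eventually_add_one_pow_le r).and
    (eventually_const_mul_pow_le_two_rpow_sqrt
      (4 * (r : ℝ) ^ r * ((2 * (4 * r) * s) ^ s * (t * r))) (r + r * s))))
  obtain ⟨n₀, hn₀⟩ := Filter.eventually_atTop.1 (hev.and (Filter.eventually_ge_atTop 1))
  refine ⟨n₀, fun n hnn V _ hV G hG hfree hcardG => ?_⟩
  obtain ⟨⟨hL1, hLr, hLK⟩, hn⟩ := hn₀ n hnn
  have hn0 : (0 : ℝ) < n := by exact_mod_cast hn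
  set L := Real.logb 2 (n : ℝ)
  have hL0 : 0 < L := by linarith
  have hr3 : (3 : ℝ) ≤ r := by exact_mod_cast hr
  have hLr1 : 1 ≤ L ^ r := one_le_pow₀ hL1
  obtain ⟨parts, hdisj, hcov, hcard, hE⟩ := exists_balanced_partition hn V hV G hG
  set E := G.filter fun e => ∀ i, (e ∩ parts i).card = 1
  have hEpart : ∀ e ∈ E, ∀ i, (e ∩ parts i).card = 1 := fun e he => (mem_filter.1 he).2
  have hEfib (i : Fin r) (T : Finset V) : (E.filter fun e => e \ parts i = T).card ≤ n := by
    have h := card_le_of_determined_by_parts hcard (E.filter fun e => e \ parts i = T)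
      (fun e he => hEpart e (mem_filter.1 he).1) {i} 1 ?_
    · simpa using h
    · intro e he
      refine card_le_one.2 fun a ha b hb => ?_
      obtain ⟨ha1, ha2⟩ := mem_filter.1 ha
      obtain ⟨hb1, hb2⟩ := mem_filter.1 hb
      have h1 := ha2 i (mem_singleton_self i)
      have h2 := hb2 i (mem_singleton_self i)
      rw [← sdiff_union_inter a (parts i), ← sdiff_union_inter b (parts i), h1, h2,
        (mem_filter.1 ha1).2, (mem_filter.1 hb1).2]
  obtain ⟨H, hHE, k, hHcard, hHdeg⟩ := exists_subset_regular_fibers E (fun i e => e \ parts i) n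
    hEfib (1 / (2 * r * L ^ r)) (by positivity)
  have hHG : H ⊆ G := hHE.trans (filter_subset _ _)
  have hHpart : ∀ e ∈ H, ∀ i, (e ∩ parts i).card = 1 := fun e he => hEpart e (hHE he)
  refine ⟨H, hHG, parts, ⟨hdisj, hcov, hcard, hHpart⟩, ?_⟩
  refine regularHG_of_comparable_degrees (t := t) (Q := 4 * (r : ℝ) ^ r * L ^ r) hr hs ht hn hcov
    hcard (fun e he => hG e (hHG he)) hHpart (hfree.mono hHG) ?_ ?_ hε (by positivity) ?_ ?_ ?_
  · nlinarith
  · have : (1 : ℝ) ≤ (r : ℝ) ^ r := one_le_pow₀ (by linarith)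
    nlinarith
  · intro i e he f hf
    have h1 := (hHdeg i e he).2
    have h2 := (hHdeg i f hf).1
    rw [one_div, ← div_eq_inv_mul, div_le_iff₀ (by positivity)] at h2
    linarith
  · rw [Fintype.card_fin] at hHcard
    have hm : ((Nat.log 2 n : ℝ) + 1) ^ r ≤ 4 / 3 * L ^ r := by
      have h1 : (Nat.log 2 n : ℝ) ≤ L := by
        simpa using Real.natLog_le_logb n 2
      have h2 : ((Nat.log 2 n : ℝ) + 1) ^ r ≤ (L + 1) ^ r := by gcongr
      linarith
    have h1 : (E.card : ℝ) / (4 / 3 * L ^ r) ≤ E.card / ((Nat.log 2 n : ℝ) + 1) ^ r := by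
      gcongr
    have h2 : (E.card : ℝ) / (4 / 3 * L ^ r) - r * (1 / (2 * r * L ^ r) * E.card)
        = E.card / (4 * L ^ r) := by
      field_simp
      ring
    have h3 : (E.card : ℝ) / (4 * L ^ r) ≤ H.card := by linarith
    rw [div_le_iff₀ (by positivity)] at h3
    have h4 : (G.card : ℝ) ≤ (r : ℝ) ^ r * E.card := by exact_mod_cast hE
    calc _ ≤ (G.card : ℝ) := hcardG
      _ ≤ (r : ℝ) ^ r * E.card := h4
      _ ≤ (r : ℝ) ^ r * (H.card * (4 * L ^ r)) := by gcongr
      _ = _ := by ring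
  · rw [rpow_inv_sqrt_logb hn0]
    refine le_trans (le_of_eq ?_) hLK
    rw [pow_add, pow_mul, show 2 * (4 * (r : ℝ) * L ^ r) * s = 2 * (4 * r) * s * L ^ r by ring,
      mul_pow _ (L ^ r)]
    ring

end
end

section
/- Let ε, δ, α > 0 with 6(s+1)(ε+δ) ≤ 1 and α = o(n^ε), and let ℋ₁ ⊆ ℋ ⊆ 𝒢₁ ⊆ 𝒢 be a nested sequence of (ε,α)-regular K_{s,t}^{(r)}-free r-uniform r-partite hypergraphs with common parts V_1,…,V_r of size n, with n sufficiently large. If V_i →_δ^{ℋ₁,ℋ} V_j →_δ^{𝒢₁,𝒢} V_k holds with j ∉ {i,k}, then k = i. -/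
open Finset
open scoped Classical

noncomputable section

variable {V : Type}

lemma pow_le_choose_add (s m : ℕ) (hs : 1 ≤ s) :
    m ^ s ≤ s ^ s * s.factorial * (m.choose s + m) := by
  have hf : 1 ≤ s.factorial := s.factorial_pos
  rcases lt_or_ge m s with h | h
  · obtain ⟨u, rfl⟩ : ∃ u, s = u + 1 := ⟨s - 1, by omega⟩
    calc m ^ (u + 1) = m ^ u * m := pow_succ _ _
      _ ≤ (u + 1) ^ u * m := by gcongr
      _ ≤ (u + 1) ^ (u + 1) * m := by gcongr; omega
      _ ≤ (u + 1) ^ (u + 1) * (u + 1).factorial * ((m.choose (u + 1)) + m) := by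
          rw [mul_assoc]
          gcongr
          nlinarith [Nat.zero_le (m.choose (u + 1))]
  · have h1 : m ≤ s * (m + 1 - s) := by
      obtain ⟨d, rfl⟩ := Nat.exists_eq_add_of_le h
      have : s + d + 1 - s = d + 1 := by omega
      rw [this]
      nlinarith
    have h2 : (m + 1 - s) ^ s ≤ s.factorial * m.choose s := by
      rw [← Nat.descFactorial_eq_factorial_mul_choose]
      exact m.pow_sub_le_descFactorial s
    calc m ^ s ≤ (s * (m + 1 - s)) ^ s := by gcongr
      _ = s ^ s * (m + 1 - s) ^ s := mul_pow _ _ _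
      _ ≤ s ^ s * (s.factorial * m.choose s) := by gcongr
      _ ≤ s ^ s * s.factorial * (m.choose s + m) := by
          rw [mul_assoc]
          gcongr
          omega

lemma sum_card_filter_mem_eq_sum_card_inter {ι : Type} (𝒬 : Finset ι) (N : ι → Finset V)
    (A : Finset V) :
    ∑ v ∈ A, #{R ∈ 𝒬 | v ∈ N R} = ∑ R ∈ 𝒬, #(N R ∩ A) := by
  have h := sum_card_bipartiteAbove_eq_sum_card_bipartiteBelow (fun v R => v ∈ N R)
    (s := A) (t := 𝒬)
  simp only [bipartiteAbove, bipartiteBelow] at h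
  rw [h]
  refine sum_congr rfl fun R _ => ?_
  rw [inter_comm, filter_mem_eq_inter]

lemma card_powersetCard_filter_mem_le (A : Finset V) (v : V) (s : ℕ) :
    #{S ∈ A.powersetCard s | v ∈ S} ≤ #A ^ (s - 1) := by
  calc #{S ∈ A.powersetCard s | v ∈ S} ≤ #(A.powersetCard (s - 1)) := by
        refine card_le_card_of_injOn (fun S => S.erase v) ?_ ?_
        · intro S hS
          simp only [coe_filter, mem_powersetCard, Set.mem_ofPred_eq] at hS
          rw [mem_coe, mem_powersetCard]
          exact ⟨(erase_subset _ _).trans hS.1.1, by rw [card_erase_of_mem hS.2, hS.1.2]⟩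
        · intro S hS S' hS' h
          simp only [coe_filter, Set.mem_ofPred_eq] at hS hS'
          rw [← insert_erase hS.2, ← insert_erase hS'.2]
          exact congrArg (insert v) h
    _ ≤ #A ^ (s - 1) := by
        rw [card_powersetCard]
        exact Nat.choose_le_pow _ _

/-- A vertex `v` of `D` contained in many popular `s`-subsets of `D` lies in many of the sets
`N R` that have a large intersection with `D`. -/
lemma le_card_filter_large_of_dense {ι : Type} (𝒬 : Finset ι) (N : ι → Finset V) (D : Finset V)
    (s : ℕ) (v : V) (hv : v ∈ D) (L E c θ : ℝ) (hL : 0 ≤ L) (hθ0 : 0 ≤ θ)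
    (hE : (#{R ∈ 𝒬 | v ∈ N R} : ℝ) ≤ E)
    (hdense : c * (#D : ℝ) ^ (s - 1) ≤
      (#{S ∈ D.powersetCard s | v ∈ S ∧ L ≤ (#{R ∈ 𝒬 | S ⊆ N R} : ℝ)} : ℝ))
    (hθ : 2 * (θ ^ (s - 1) * E) ≤ L * c) :
    L * c / 2 ≤ (#{R ∈ 𝒬 | v ∈ N R ∧ θ * #D ≤ (#(N R ∩ D) : ℝ)} : ℝ) := by
  set d : ℝ := ((#D : ℕ) : ℝ) with hd
  have hdpos : 0 < d ^ (s - 1) := by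
    have : 0 < #D := card_pos.2 ⟨v, hv⟩
    positivity
  set 𝒮 := {S ∈ D.powersetCard s | v ∈ S ∧ L ≤ (#{R ∈ 𝒬 | S ⊆ N R} : ℝ)} with h𝒮
  set 𝒬v := {R ∈ 𝒬 | v ∈ N R} with h𝒬v
  have hcount : L * (#𝒮 : ℝ) ≤ ∑ R ∈ 𝒬v, (#(N R ∩ D) : ℝ) ^ (s - 1) := by
    calc L * (#𝒮 : ℝ) = ∑ _S ∈ 𝒮, L := by rw [sum_const, nsmul_eq_mul, mul_comm]
      _ ≤ ∑ S ∈ 𝒮, (#{R ∈ 𝒬v | S ⊆ N R} : ℝ) := by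
          refine sum_le_sum fun S hS => ?_
          rw [h𝒮, mem_filter] at hS
          refine hS.2.2.trans (Nat.cast_le.2 (card_le_card fun R hR => ?_))
          rw [mem_filter] at hR
          rw [h𝒬v, mem_filter, mem_filter]
          exact ⟨⟨hR.1, hR.2 hS.2.1⟩, hR.2⟩
      _ = ∑ R ∈ 𝒬v, (#{S ∈ 𝒮 | S ⊆ N R} : ℝ) := by
          have h := sum_card_bipartiteAbove_eq_sum_card_bipartiteBelow
            (fun (S : Finset V) R => S ⊆ N R) (s := 𝒮) (t := 𝒬v)
          simp only [bipartiteAbove, bipartiteBelow] at h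
          exact_mod_cast h
      _ ≤ _ := by
          refine sum_le_sum fun R hR => ?_
          rw [← Nat.cast_pow, Nat.cast_le]
          refine le_trans (card_le_card fun S hS => ?_)
            (card_powersetCard_filter_mem_le (N R ∩ D) v s)
          rw [mem_filter, h𝒮, mem_filter, mem_powersetCard] at hS
          rw [mem_filter, mem_powersetCard]
          exact ⟨⟨subset_inter hS.2 hS.1.1.1, hS.1.1.2⟩, hS.1.2.1⟩
  have hsplit : ∑ R ∈ 𝒬v, (#(N R ∩ D) : ℝ) ^ (s - 1) ≤
      (#{R ∈ 𝒬 | v ∈ N R ∧ θ * d ≤ (#(N R ∩ D) : ℝ)} : ℝ) * d ^ (s - 1)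
        + E * (θ * d) ^ (s - 1) := by
    rw [← sum_filter_add_sum_filter_not 𝒬v (fun R => θ * d ≤ (#(N R ∩ D) : ℝ))]
    refine add_le_add ?_ ?_
    · rw [h𝒬v, filter_filter, ← nsmul_eq_mul]
      refine sum_le_card_nsmul _ _ _ fun R _ => ?_
      have : (#(N R ∩ D) : ℝ) ≤ d := Nat.cast_le.2 (card_le_card inter_subset_right)
      gcongr
    · refine (sum_le_card_nsmul _ _ ((θ * d) ^ (s - 1)) fun R hR => ?_).trans ?_
      · rw [mem_filter, not_le] at hR
        have := hR.2.le
        gcongr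
      · rw [nsmul_eq_mul]
        have : 0 ≤ θ * d := by positivity
        gcongr
        refine le_trans (Nat.cast_le.2 (card_le_card (filter_subset _ _))) hE
  have h3 := (mul_le_mul_of_nonneg_left hdense hL).trans (hcount.trans hsplit)
  rw [mul_pow] at h3
  refine le_of_mul_le_mul_right ?_ hdpos
  nlinarith [mul_le_mul_of_nonneg_right hθ hdpos.le]

/-- Bounded multiplicity limits the number of sets `N R` having a large intersection with `D`. -/
lemma card_filter_large_mul_le {ι : Type} (𝒬 : Finset ι) (N : ι → Finset V) (D : Finset V)
    (E θ : ℝ) (hD : D.Nonempty) (hE : ∀ v ∈ D, (#{R ∈ 𝒬 | v ∈ N R} : ℝ) ≤ E) :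
    (#{R ∈ 𝒬 | θ * #D ≤ (#(N R ∩ D) : ℝ)} : ℝ) * θ ≤ E := by
  have hd : (0 : ℝ) < #D := by exact_mod_cast card_pos.2 hD
  refine le_of_mul_le_mul_right ?_ hd
  calc (#{R ∈ 𝒬 | θ * #D ≤ (#(N R ∩ D) : ℝ)} : ℝ) * θ * #D
      = #{R ∈ 𝒬 | θ * #D ≤ (#(N R ∩ D) : ℝ)} • (θ * #D) := by rw [nsmul_eq_mul, mul_assoc]
    _ ≤ ∑ R ∈ 𝒬 with θ * #D ≤ (#(N R ∩ D) : ℝ), (#(N R ∩ D) : ℝ) :=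
        card_nsmul_le_sum _ _ _ fun R hR => (mem_filter.1 hR).2
    _ ≤ ∑ R ∈ 𝒬, (#(N R ∩ D) : ℝ) :=
        sum_le_sum_of_subset_of_nonneg (filter_subset _ _) fun _ _ _ => Nat.cast_nonneg _
    _ = ∑ v ∈ D, (#{R ∈ 𝒬 | v ∈ N R} : ℝ) := by
        exact_mod_cast (sum_card_filter_mem_eq_sum_card_inter 𝒬 N D).symm
    _ ≤ #D • E := sum_le_card_nsmul _ _ _ hE
    _ = E * #D := by rw [nsmul_eq_mul, mul_comm]

/-- If all elements of `A ⊆ D` are dense, then the sets `N R` meet `A` in large sets on average,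
measured by the `s`-th moment. -/
lemma pow_card_mul_le_sum_pow_card_inter {ι : Type} (𝒬 : Finset ι) (N : ι → Finset V)
    (D A : Finset V) (hAD : A ⊆ D) (s : ℕ) (L E c θ : ℝ) (hs : 1 ≤ s) (hL : 0 < L) (hc : 0 < c)
    (hθ0 : 0 < θ) (hE0 : 0 < E) (hE : ∀ v ∈ D, (#{R ∈ 𝒬 | v ∈ N R} : ℝ) ≤ E)
    (hdense : ∀ v ∈ A, c * (#D : ℝ) ^ (s - 1) ≤
      (#{S ∈ D.powersetCard s | v ∈ S ∧ L ≤ (#{R ∈ 𝒬 | S ⊆ N R} : ℝ)} : ℝ))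
    (hθ : 2 * (θ ^ (s - 1) * E) ≤ L * c) :
    (#A : ℝ) ^ s * ((L * c / 2) ^ s * (θ / E) ^ (s - 1)) ≤ ∑ R ∈ 𝒬, (#(N R ∩ A) : ℝ) ^ s := by
  obtain ⟨u, rfl⟩ : ∃ u, s = u + 1 := ⟨s - 1, by omega⟩
  rw [Nat.add_sub_cancel] at hθ ⊢
  rcases A.eq_empty_or_nonempty with rfl | hA
  · simp
  set 𝓡 := {R ∈ 𝒬 | θ * #D ≤ (#(N R ∩ D) : ℝ)} with h𝓡
  have hcard := card_filter_large_mul_le 𝒬 N D E θ (hA.mono hAD) hE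
  rw [← h𝓡] at hcard
  have hlow : (#A : ℝ) * (L * c / 2) ≤ ∑ R ∈ 𝓡, (#(N R ∩ A) : ℝ) := by
    calc (#A : ℝ) * (L * c / 2) = #A • (L * c / 2) := by rw [nsmul_eq_mul]
      _ ≤ ∑ v ∈ A, (#{R ∈ 𝓡 | v ∈ N R} : ℝ) := by
          refine card_nsmul_le_sum _ _ _ fun v hv => ?_
          have := le_card_filter_large_of_dense 𝒬 N D (u + 1) v (hAD hv) L E c θ hL.le hθ0.le
            (hE v (hAD hv)) (hdense v hv) hθ
          refine this.trans (Nat.cast_le.2 (card_le_card fun R hR => ?_))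
          rw [mem_filter] at hR
          rw [h𝓡, mem_filter, mem_filter]
          exact ⟨⟨hR.1, hR.2.2⟩, hR.2.1⟩
      _ = _ := by exact_mod_cast sum_card_filter_mem_eq_sum_card_inter 𝓡 N A
  have hApos : (0 : ℝ) < #A := by exact_mod_cast card_pos.2 hA
  have hpos : (0 : ℝ) < ∑ R ∈ 𝓡, (#(N R ∩ A) : ℝ) := 
    lt_of_lt_of_le (mul_pos hApos (half_pos (mul_pos hL hc))) hlow
  have h𝓡pos : (0 : ℝ) < #𝓡 := by
    have : 𝓡.Nonempty := nonempty_of_sum_ne_zero hpos.ne'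
    exact_mod_cast card_pos.2 this
  have hpm := pow_sum_div_card_le_sum_pow (s := 𝓡) (f := fun R => (#(N R ∩ A) : ℝ))
    (fun _ _ => Nat.cast_nonneg _) u
  have hinv : θ / E ≤ 1 / (#𝓡 : ℝ) := by
    rw [div_le_div_iff₀ hE0 h𝓡pos]
    linarith
  calc (#A : ℝ) ^ (u + 1) * ((L * c / 2) ^ (u + 1) * (θ / E) ^ u)
      = ((#A : ℝ) * (L * c / 2)) ^ (u + 1) * (θ / E) ^ u := by rw [mul_pow, mul_assoc]
    _ ≤ (∑ R ∈ 𝓡, (#(N R ∩ A) : ℝ)) ^ (u + 1) * (1 / (#𝓡 : ℝ)) ^ u :=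
        mul_le_mul
          (pow_le_pow_left₀ (mul_pos hApos (half_pos (mul_pos hL hc))).le hlow _)
          (pow_le_pow_left₀ (div_pos hθ0 hE0).le hinv _)
          (pow_nonneg (div_pos hθ0 hE0).le _) (pow_nonneg hpos.le _)
    _ = (∑ R ∈ 𝓡, (#(N R ∩ A) : ℝ)) ^ (u + 1) / (#𝓡 : ℝ) ^ u := by
        rw [div_pow, one_pow, mul_one_div]
    _ ≤ ∑ R ∈ 𝓡, (#(N R ∩ A) : ℝ) ^ (u + 1) := hpm
    _ ≤ _ := sum_le_sum_of_subset_of_nonneg (filter_subset _ _) fun _ _ _ => by positivity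

section Partite

variable {r n : ℕ} {parts : Fin r → Finset V} {G : Finset (Finset V)}

lemma IsPartite.eq_of_mem (hG : IsPartite r n parts G) {v : V} {p q : Fin r}
    (hp : v ∈ parts p) (hq : v ∈ parts q) : p = q := by
  by_contra h
  exact disjoint_left.1 (hG.1 p q h) hp hq

lemma IsPartite.biUnion_inter (hG : IsPartite r n parts G) (A : Finset V) :
    univ.biUnion (fun p => A ∩ parts p) = A := by
  ext v
  obtain ⟨p, hp⟩ := hG.2.1 v
  simp only [mem_biUnion, mem_univ, true_and, mem_inter]
  exact ⟨fun ⟨_, h, _⟩ => h, fun h => ⟨p, h, hp⟩⟩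

lemma IsPartite.card_eq_sum (hG : IsPartite r n parts G) (A : Finset V) :
    #A = ∑ p, #(A ∩ parts p) := by
  conv_lhs => rw [← hG.biUnion_inter A]
  refine card_biUnion fun p _ q _ hpq => ?_
  exact (hG.1 p q hpq).mono inter_subset_right inter_subset_right

lemma IsPartite.card_edge (hG : IsPartite r n parts G) {e : Finset V} (he : e ∈ G) : #e = r := by
  rw [hG.card_eq_sum, sum_congr rfl fun p _ => hG.2.2.2 e he p]
  simp

/-- Sets meeting each part of `J` in one vertex and having a prescribed intersection with the
other parts number at most `n ^ #J`. -/
lemma IsPartite.card_transversal_le (hG : IsPartite r n parts G) (J : Finset (Fin r))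
    (Z : Fin r → Finset V) (𝒜 : Finset (Finset V))
    (h1 : ∀ A ∈ 𝒜, ∀ p ∈ J, #(A ∩ parts p) = 1) (h2 : ∀ A ∈ 𝒜, ∀ p ∉ J, A ∩ parts p = Z p) :
    #𝒜 ≤ n ^ #J := by
  have hcard : #(J.pi fun p => (parts p).powersetCard 1) = n ^ #J := by
    rw [card_pi]
    simp [hG.2.2.1]
  rw [← hcard]
  refine card_le_card_of_injOn (fun A p _ => A ∩ parts p) ?_ ?_
  · intro A hA
    rw [mem_coe, mem_pi]
    intro p hp
    rw [mem_powersetCard]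
    exact ⟨inter_subset_right, h1 A hA p hp⟩
  · intro A hA B hB h
    rw [← hG.biUnion_inter A, ← hG.biUnion_inter B]
    congr 1
    funext p
    by_cases hp : p ∈ J
    · exact congrFun (congrFun h p) hp
    · rw [h2 A hA p hp, h2 B hB p hp]

lemma inter_eq_singleton {A P : Finset V} {u : V} (hA : u ∈ A) (hP : u ∈ P)
    (h : #(A ∩ P) = 1) : A ∩ P = {u} := by
  obtain ⟨x, hx⟩ := card_eq_one.1 h
  have : u ∈ A ∩ P := mem_inter.2 ⟨hA, hP⟩
  rw [hx, mem_singleton] at this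
  rw [hx, this]

lemma IsPartite.sdiff_inter_of_ne (hG : IsPartite r n parts G) (A : Finset V) {p l : Fin r}
    (h : p ≠ l) : (A \ parts l) ∩ parts p = A ∩ parts p := by
  ext v
  simp only [mem_inter, mem_sdiff]
  exact ⟨fun h => ⟨h.1.1, h.2⟩,
    fun hv => ⟨⟨hv.1, fun hl => h (hG.eq_of_mem hv.2 hl)⟩, hv.2⟩⟩

/-- Some `(r-1)`-tuple avoiding a given part has at least average degree. -/
lemma IsPartite.exists_tuple_degSet_ge (hG : IsPartite r n parts G) (j : Fin r)
    (hne : G.Nonempty) :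
    ∃ T : Finset V, #T = r - 1 ∧ Disjoint T (parts j) ∧ 1 ≤ degSet G T ∧
      (∀ p, p ≠ j → #(T ∩ parts p) = 1) ∧ #G ≤ n ^ (r - 1) * degSet G T := by
  have himage : #(G.image fun e => e \ parts j) ≤ n ^ (r - 1) := by
    have hJ : #(univ \ {j} : Finset (Fin r)) = r - 1 := by
      rw [card_sdiff_of_subset (subset_univ _), card_univ, Fintype.card_fin, card_singleton]
    rw [← hJ]
    refine hG.card_transversal_le _ (fun _ => ∅) _ ?_ ?_
    · intro A hA x hx
      obtain ⟨e, he, rfl⟩ := mem_image.1 hA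
      simp only [mem_sdiff, mem_univ, true_and, mem_singleton] at hx
      rw [hG.sdiff_inter_of_ne e hx]
      exact hG.2.2.2 e he x
    · intro A hA x hx
      obtain ⟨e, he, rfl⟩ := mem_image.1 hA
      simp only [mem_sdiff, mem_univ, true_and, not_not, mem_singleton] at hx
      rw [hx]
      exact sdiff_inter_self _ _
  obtain ⟨T, hT, hmax⟩ := exists_max_image (G.image fun e => e \ parts j) (degSet G)
    (hne.image _)
  have hle : #G ≤ n ^ (r - 1) * degSet G T := by
    rw [card_eq_sum_card_image (fun e => e \ parts j) G]
    refine (sum_le_card_nsmul _ _ (degSet G T) fun Q hQ => ?_).trans ?_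
    · refine le_trans (card_le_card fun e he => ?_) (hmax Q hQ)
      rw [mem_filter] at he ⊢
      exact ⟨he.1, he.2 ▸ sdiff_subset⟩
    · rw [smul_eq_mul]
      exact Nat.mul_le_mul_right _ himage
  obtain ⟨e, he, rfl⟩ := mem_image.1 hT
  refine ⟨_, ?_, sdiff_disjoint, ?_, ?_, hle⟩
  · have h4 := hG.card_edge he
    have h5 := card_sdiff_add_card_inter e (parts j)
    have h6 := hG.2.2.2 e he j
    omega
  · exact card_pos.2 ⟨e, mem_filter.2 ⟨he, sdiff_subset⟩⟩
  · intro p hp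
    rw [hG.sdiff_inter_of_ne e hp]
    exact hG.2.2.2 e he p

variable [Fintype V]

lemma mem_linkN {T : Finset V} {v : V} : v ∈ linkN G T ↔ v ∉ T ∧ insert v T ∈ G := by
  simp [linkN]

lemma IsPartite.inter_of_mem_linkN (hG : IsPartite r n parts G) {R : Finset V} {v : V}
    {q : Fin r} (hv : v ∈ linkN G R) (hq : v ∈ parts q) :
    R ∩ parts q = ∅ ∧ ∀ p, p ≠ q → #(R ∩ parts p) = 1 := by
  rw [mem_linkN] at hv
  constructor
  · have h := hG.2.2.2 _ hv.2 q
    rw [insert_inter_of_mem hq, card_insert_of_notMem (fun h => hv.1 (mem_inter.1 h).1)] at h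
    exact card_eq_zero.1 (by omega)
  · intro p hp
    have h := hG.2.2.2 _ hv.2 p
    rwa [insert_inter_of_notMem fun h => hp (hG.eq_of_mem h hq)] at h

lemma IsPartite.linkN_subset (hG : IsPartite r n parts G) {T : Finset V} {j : Fin r}
    (hT : Disjoint T (parts j)) : linkN G T ⊆ parts j := by
  intro v hv
  rw [mem_linkN] at hv
  by_contra h
  have h1 := hG.2.2.2 _ hv.2 j
  rw [insert_inter_of_notMem h, disjoint_iff_inter_eq_empty.1 hT] at h1
  simp at h1

lemma IsPartite.card_of_mem_linkN (hG : IsPartite r n parts G) {R : Finset V} {v : V}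
    (hv : v ∈ linkN G R) : #R = r - 1 := by
  rw [mem_linkN] at hv
  have h := hG.card_edge hv.2
  rw [card_insert_of_notMem hv.1] at h
  omega

lemma IsPartite.degSet_eq (hG : IsPartite r n parts G) {T : Finset V} (hr : 1 ≤ r)
    (hT : #T = r - 1) : degSet G T = #(linkN G T) := by
  symm
  refine card_bij (fun v _ => insert v T) ?_ ?_ ?_
  · intro v hv
    exact mem_filter.2 ⟨(mem_linkN.1 hv).2, subset_insert _ _⟩
  · intro v hv w hw h
    have : v ∈ insert w T := h ▸ mem_insert_self v T
    exact (mem_insert.1 this).resolve_right (mem_linkN.1 hv).1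
  · intro e he
    rw [mem_filter] at he
    have hc := hG.card_edge he.1
    have h1 : #(e \ T) = 1 := by
      rw [card_sdiff_of_subset he.2]
      omega
    obtain ⟨v, hv⟩ := card_eq_one.1 h1
    have hve : v ∈ e \ T := hv ▸ mem_singleton_self v
    have he' : insert v T = e := by
      rw [insert_eq, ← hv, sdiff_union_of_subset he.2]
    exact ⟨v, mem_linkN.2 ⟨(mem_sdiff.1 hve).2, he' ▸ he.1⟩, he'⟩

/-- The `(r-1)`-sets containing `u`. -/
def tuplesThrough (r : ℕ) (u : V) : Finset (Finset V) :=
  univ.filter fun R => #R = r - 1 ∧ u ∈ R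

lemma mem_tuplesThrough {r : ℕ} {u : V} {R : Finset V} :
    R ∈ tuplesThrough r u ↔ #R = r - 1 ∧ u ∈ R := by
  simp [tuplesThrough]

lemma cdOn_eq (r : ℕ) (G : Finset (Finset V)) (S : Finset V) (u : V) :
    cdOn r G S u = #{R ∈ tuplesThrough r u | S ⊆ linkN G R} := by
  unfold cdOn CN tuplesThrough
  rw [filter_filter, filter_filter]
  congr 1
  ext R
  simp only [mem_filter, mem_univ, true_and, subset_iff, mem_linkN]
  tauto

/-- Codegrees of pairs of vertices are bounded in terms of the degrees of `(r-1)`-tuples. -/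
lemma IsPartite.card_tuplesThrough_filter_mem_linkN_le (hG : IsPartite r n parts G)
    {p q l : Fin r} (hpq : p ≠ q) (hpl : p ≠ l) (hql : q ≠ l) {u v : V} (hu : u ∈ parts p)
    (hv : v ∈ parts q) {Y : ℝ} (hY : 0 ≤ Y)
    (hdeg : ∀ T : Finset V, #T = r - 1 → Disjoint T (parts l) → (degSet G T : ℝ) ≤ Y) :
    (#{R ∈ tuplesThrough r u | v ∈ linkN G R} : ℝ) ≤ (n : ℝ) ^ (r - 3) * Y := by
  set 𝒜 := {R ∈ tuplesThrough r u | v ∈ linkN G R} with h𝒜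
  have hmem : ∀ R ∈ 𝒜, u ∈ R ∧ v ∈ linkN G R := fun R hR => by
    rw [h𝒜, mem_filter, mem_tuplesThrough] at hR
    exact ⟨hR.1.2, hR.2⟩
  have hvu : v ∉ parts l := fun h => hql (hG.eq_of_mem hv h)
  have himage : #(𝒜.image fun R => R \ parts l) ≤ n ^ (r - 3) := by
    have hJ : #(univ \ {p, q, l} : Finset (Fin r)) = r - 3 := by
      rw [card_sdiff_of_subset (subset_univ _), card_univ, Fintype.card_fin,
        card_eq_three.2 ⟨p, q, l, hpq, hpl, hql, rfl⟩]
    rw [← hJ]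
    refine hG.card_transversal_le _ (fun x => if x = p then {u} else ∅) _ ?_ ?_
    · intro A hA x hx
      obtain ⟨R, hR, rfl⟩ := mem_image.1 hA
      simp only [mem_sdiff, mem_univ, true_and, mem_insert, mem_singleton, not_or] at hx
      rw [hG.sdiff_inter_of_ne R hx.2.2]
      exact (hG.inter_of_mem_linkN (hmem R hR).2 hv).2 x hx.2.1
    · intro A hA x hx
      obtain ⟨R, hR, rfl⟩ := mem_image.1 hA
      obtain ⟨h1, h2⟩ := hmem R hR
      have h3 := hG.inter_of_mem_linkN h2 hv
      simp only [mem_sdiff, mem_univ, true_and, not_not, mem_insert, mem_singleton] at hx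
      rcases hx with rfl | rfl | rfl
      · rw [if_pos rfl, hG.sdiff_inter_of_ne R hpl]
        exact inter_eq_singleton h1 hu (h3.2 _ hpq)
      · rw [if_neg hpq.symm, hG.sdiff_inter_of_ne R hql]
        exact h3.1
      · rw [if_neg hpl.symm]
        exact sdiff_inter_self _ _
  have hfiber : ∀ Q ∈ 𝒜.image (fun R => R \ parts l),
      (#{R ∈ 𝒜 | R \ parts l = Q} : ℝ) ≤ Y := by
    intro Q hQ
    obtain ⟨R₀, hR₀, rfl⟩ := mem_image.1 hQ
    obtain ⟨-, h2⟩ := hmem R₀ hR₀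
    have h3 := (hG.inter_of_mem_linkN h2 hv).2 l hql.symm
    have hvR : v ∉ R₀ \ parts l := fun h => (mem_linkN.1 h2).1 (mem_sdiff.1 h).1
    refine le_trans (Nat.cast_le.2 ?_) (hdeg (insert v (R₀ \ parts l)) ?_ ?_)
    · refine card_le_card_of_injOn (fun R => insert v R) ?_ ?_
      · intro R hR
        rw [mem_coe, mem_filter] at hR
        rw [mem_coe, mem_filter]
        refine ⟨(mem_linkN.1 (hmem R hR.1).2).2, ?_⟩
        rw [← hR.2]
        exact insert_subset_insert _ sdiff_subset
      · intro R hR R' hR' h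
        rw [mem_coe, mem_filter] at hR hR'
        have e1 := (mem_linkN.1 (hmem R hR.1).2).1
        have e2 := (mem_linkN.1 (hmem R' hR'.1).2).1
        rw [← erase_insert e1, ← erase_insert e2]
        exact congrArg (fun A => A.erase v) h
    · rw [card_insert_of_notMem hvR]
      have h4 := hG.card_of_mem_linkN h2
      have h5 := card_sdiff_add_card_inter R₀ (parts l)
      omega
    · rw [disjoint_insert_left]
      exact ⟨hvu, sdiff_disjoint⟩
  have hcount := card_eq_sum_card_image (fun R => R \ parts l) 𝒜
  rw [hcount, Nat.cast_sum]
  refine (sum_le_card_nsmul _ _ _ hfiber).trans ?_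
  rw [nsmul_eq_mul]
  refine mul_le_mul_of_nonneg_right ?_ hY
  exact_mod_cast himage

/-- In a `K_{s,t}^{(r)}`-free hypergraph the common link of an `s`-set has a small vertex cover. -/
lemma KstFree.exists_isVertexCover {s t : ℕ} (hr : 2 ≤ r) (hG : KstFree r s t G)
    (S : Finset V) (hS : #S = s) :
    ∃ C : Finset V, #C ≤ t * r ∧ IsVertexCover C (CN r G S) := by
  obtain ⟨F, hF, hmax⟩ := exists_max_image
    ((CN r G S).powerset.filter fun F : Finset (Finset V) =>
      (F : Set (Finset V)).PairwiseDisjoint id) card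
    ⟨∅, by simp⟩
  rw [mem_filter, mem_powerset] at hF
  have hCN : ∀ R ∈ F, #R = r - 1 ∧ ∀ v ∈ S, v ∉ R ∧ insert v R ∈ G := fun R hR => by
    simpa [CN] using hF.1 hR
  have hFt : #F < t := by
    by_contra! h
    obtain ⟨F', hF', hcard⟩ := exists_subset_card_eq h
    let f : Fin t ≃ F' := (F'.equivFinOfCardEq hcard).symm
    refine hG ⟨fun i => (f i : Finset V), S, fun i => (hCN _ (hF' (f i).2)).1, hS, ?_, ?_, ?_⟩
    · intro i j hij
      exact hF.2 (hF' (f i).2) (hF' (f j).2) fun h => hij (f.injective (Subtype.ext h))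
    · intro i
      rw [disjoint_right]
      exact fun v hv => ((hCN _ (hF' (f i).2)).2 v hv).1
    · intro i y hy
      exact ((hCN _ (hF' (f i).2)).2 y hy).2
  refine ⟨F.biUnion id, ?_, ?_⟩
  · refine (card_biUnion_le_card_mul _ _ r fun R hR => ?_).trans ?_
    · have := (hCN R hR).1
      simp only [id]
      omega
    · exact Nat.mul_le_mul_right _ hFt.le
  · intro R hR
    by_contra! h
    have hRdisj : ∀ Q ∈ F, Disjoint R Q := fun Q hQ => by
      rw [disjoint_right]
      exact fun c hc => h c (mem_biUnion.2 ⟨Q, hQ, hc⟩)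
    have hRF : R ∉ F := fun hRF => by
      have h1 := hRdisj R hRF
      rw [disjoint_self_iff_empty] at h1
      have h2 := (hCN R hRF).1
      rw [h1, card_empty] at h2
      omega
    have h3 := hmax (insert R F) (by
      rw [mem_filter, mem_powerset, insert_subset_iff]
      refine ⟨⟨hR, hF.1⟩, ?_⟩
      rw [coe_insert]
      exact hF.2.insert fun Q hQ _ => hRdisj Q hQ)
    rw [card_insert_of_notMem hRF] at h3
    omega

/-- In a `K_{s,t}^{(r)}`-free hypergraph the common link of an `s`-set in one part is concentrated
on few vertices of any other part. -/
lemma IsPartite.sum_cdOn_le {s t : ℕ} (hP : IsPartite r n parts G) (hr : 3 ≤ r) (hs : 1 ≤ s)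
    (hG : KstFree r s t G) {i j k : Fin r} (hij : i ≠ j) (hik : i ≠ k) (hjk : j ≠ k)
    {Y : ℝ} (hY : 0 ≤ Y)
    (hdeg : ∀ T : Finset V, #T = r - 1 → Disjoint T (parts i) → (degSet G T : ℝ) ≤ Y)
    (S D : Finset V) (hS : #S = s) (hSk : S ⊆ parts k) (hD : D ⊆ parts j) (hDY : (#D : ℝ) ≤ Y) :
    ∑ v ∈ D, (cdOn r G S v : ℝ) ≤ 2 * (t * r : ℕ) * ((n : ℝ) ^ (r - 3) * Y) := by
  obtain ⟨C, hC, hcov⟩ := hG.exists_isVertexCover (by omega) S hS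
  obtain ⟨w, hw⟩ : S.Nonempty := card_pos.1 (by omega)
  set E : ℝ := (n : ℝ) ^ (r - 3) * Y with hEdef
  have hE : 0 ≤ E := by positivity
  have hCr : (#C : ℝ) ≤ (t * r : ℕ) := by exact_mod_cast hC
  have hbound : ∀ v ∈ D, (cdOn r G S v : ℝ) ≤ E := fun v hv => by
    refine le_trans (Nat.cast_le.2 ?_) (hP.card_tuplesThrough_filter_mem_linkN_le hjk
      hij.symm hik.symm (hD hv) (hSk hw) hY hdeg)
    rw [cdOn_eq]
    exact card_le_card (monotone_filter_right _ fun R _ hR => hR hw)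
  have hsmall : ∀ v ∈ D, v ∉ C → (cdOn r G S v : ℝ) ≤ #C * (n : ℝ) ^ (r - 3) := by
    intro v hv hvC
    have hsub : {R ∈ CN r G S | v ∈ R} ⊆
        C.biUnion fun c => {R ∈ CN r G S | v ∈ R ∧ c ∈ R} := by
      intro R hR
      rw [mem_filter] at hR
      obtain ⟨c, hc, hcR⟩ := hcov R hR.1
      exact mem_biUnion.2 ⟨c, hc, mem_filter.2 ⟨hR.1, hR.2, hcR⟩⟩
    have hle : cdOn r G S v ≤ #C * n ^ (r - 3) := by
      refine (card_le_card hsub).trans (card_biUnion_le_card_mul _ _ _ fun c hc => ?_)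
      have hlink : ∀ R ∈ {R ∈ CN r G S | v ∈ R ∧ c ∈ R}, w ∈ linkN G R ∧ v ∈ R ∧ c ∈ R := by
        intro R hR
        rw [mem_filter] at hR
        have h1 : #R = r - 1 ∧ ∀ v ∈ S, v ∉ R ∧ insert v R ∈ G := by simpa [CN] using hR.1
        exact ⟨mem_linkN.2 (h1.2 w hw), hR.2⟩
      obtain ⟨p, hp⟩ := hP.2.1 c
      rcases eq_empty_or_nonempty {R ∈ CN r G S | v ∈ R ∧ c ∈ R} with h0 | ⟨R₀, hR₀⟩
      · rw [h0, card_empty]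
        exact Nat.zero_le _
      obtain ⟨hw₀, hv₀, hc₀⟩ := hlink R₀ hR₀
      have hI₀ := hP.inter_of_mem_linkN hw₀ (hSk hw)
      have hpk : p ≠ k := by
        rintro rfl
        exact notMem_empty c (hI₀.1 ▸ mem_inter.2 ⟨hc₀, hp⟩)
      have hpj : p ≠ j := by
        rintro rfl
        have h1 := inter_eq_singleton hv₀ (hD hv) (hI₀.2 p hpk)
        have h2 : c ∈ R₀ ∩ parts p := mem_inter.2 ⟨hc₀, hp⟩
        rw [h1, mem_singleton] at h2
        exact hvC (h2 ▸ hc)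
      have hJ : #(univ \ {p, j, k} : Finset (Fin r)) = r - 3 := by
        rw [card_sdiff_of_subset (subset_univ _), card_univ, Fintype.card_fin,
          card_eq_three.2 ⟨p, j, k, hpj, hpk, hjk, rfl⟩]
      rw [← hJ]
      refine hP.card_transversal_le _
        (fun x => if x = p then {c} else if x = j then {v} else ∅) _ ?_ ?_
      · intro R hR x hx
        simp only [mem_sdiff, mem_univ, true_and, mem_insert, mem_singleton, not_or] at hx
        exact (hP.inter_of_mem_linkN (hlink R hR).1 (hSk hw)).2 x hx.2.2
      · intro R hR x hx
        obtain ⟨h1, h2, h3⟩ := hlink R hR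
        have h4 := hP.inter_of_mem_linkN h1 (hSk hw)
        simp only [mem_sdiff, mem_univ, true_and, not_not, mem_insert, mem_singleton] at hx
        rcases hx with rfl | rfl | rfl
        · rw [if_pos rfl]
          exact inter_eq_singleton h3 hp (h4.2 _ hpk)
        · rw [if_neg hpj.symm, if_pos rfl]
          exact inter_eq_singleton h2 (hD hv) (h4.2 _ hjk)
        · rw [if_neg hpk.symm, if_neg hjk.symm]
          exact h4.1
    exact_mod_cast hle
  rw [← sum_filter_add_sum_filter_not D (· ∈ C)]
  have h1 : ∑ v ∈ D with v ∈ C, (cdOn r G S v : ℝ) ≤ (t * r : ℕ) * E := by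
    refine (sum_le_card_nsmul _ _ E fun v hv => hbound v (mem_filter.1 hv).1).trans ?_
    rw [nsmul_eq_mul]
    refine mul_le_mul_of_nonneg_right (le_trans (Nat.cast_le.2 (card_le_card fun v hv => ?_)) hCr)
      hE
    exact (mem_filter.1 hv).2
  have h2 : ∑ v ∈ D with v ∉ C, (cdOn r G S v : ℝ) ≤ (t * r : ℕ) * E := by
    refine (sum_le_card_nsmul _ _ (#C * (n : ℝ) ^ (r - 3)) fun v hv =>
      hsmall v (mem_filter.1 hv).1 (mem_filter.1 hv).2).trans ?_
    rw [nsmul_eq_mul]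
    calc (#{v ∈ D | v ∉ C} : ℝ) * (#C * (n : ℝ) ^ (r - 3))
        ≤ Y * ((t * r : ℕ) * (n : ℝ) ^ (r - 3)) := by
          refine mul_le_mul (le_trans (Nat.cast_le.2 (card_le_card (filter_subset _ _))) hDY)
            (mul_le_mul_of_nonneg_right hCr (by positivity)) (by positivity) hY
      _ = (t * r : ℕ) * E := by rw [hEdef]; ring
  linarith

end Partite

section Arrows

variable {r s n : ℕ} {parts : Fin r → Finset V}

lemma degSet_mono {H G : Finset (Finset V)} (h : H ⊆ G) (T : Finset V) :
    degSet H T ≤ degSet G T :=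
  card_le_card (filter_subset_filter _ h)

variable [Fintype V]

lemma linkN_mono {H G : Finset (Finset V)} (h : H ⊆ G) (T : Finset V) :
    linkN H T ⊆ linkN G T := by
  intro v hv
  rw [mem_linkN] at hv ⊢
  exact ⟨hv.1, h hv.2⟩

lemma DenseOn.le_card {G : Finset (Finset V)} (hG : IsPartite r n parts G) (hr : 1 ≤ r)
    {T : Finset V} (hT : #T = r - 1) {v u : V} {δ L : ℝ} (h : DenseOn r s n G T v u δ)
    (hL : L = (n : ℝ) ^ ((r : ℝ) - 2 - 1 / ((s : ℝ) - 1) - δ)) :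
    1 / (r : ℝ) * (#(linkN G T) : ℝ) ^ (s - 1) ≤
      (#{S ∈ (linkN G T).powersetCard s |
        v ∈ S ∧ L ≤ (#{R ∈ tuplesThrough r u | S ⊆ linkN G R} : ℝ)} : ℝ) := by
  unfold DenseOn at h
  simp only [← cdOn_eq, hL, one_div_mul_eq_div]
  rwa [hG.degSet_eq hr hT] at h

/-- The first arrow yields a dense bipartite graph between a vertex link and another part. -/
lemma Arrow.exists_dense_link (hr : 3 ≤ r) {H₁ H : Finset (Finset V)} (hsub : H₁ ⊆ H)
    (hH₁ : IsPartite r n parts H₁) (hH : IsPartite r n parts H) (hne : H₁.Nonempty)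
    {i j k : Fin r} (hij : i ≠ j) (hik : i ≠ k) (hjk : j ≠ k) {δ Y L q θ : ℝ} (hY : 0 < Y)
    (hn : 1 ≤ n) (hq : 0 < q) (hθ : 0 < θ) (hθq : θ ^ (s - 1) = q)
    (hdeg : ∀ l, ∀ T : Finset V, #T = r - 1 → Disjoint T (parts l) → (degSet H T : ℝ) ≤ Y)
    (hL : L = (n : ℝ) ^ ((r : ℝ) - 2 - 1 / ((s : ℝ) - 1) - δ))
    (hLq : L * (1 / r) = 2 * (q * ((n : ℝ) ^ (r - 3) * Y)))
    (harrow : Arrow r s n parts H₁ H i j δ) :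
    ∃ D Q W : Finset V, D ⊆ parts j ∧ D.Nonempty ∧ (#D : ℝ) ≤ Y ∧
      #H₁ ≤ n ^ (r - 1) * #D ∧ Disjoint Q (parts k) ∧ W ⊆ parts k ∧
      #D * (q * θ / 2 * #W + q * Y / 2) ≤
        ∑ v ∈ D, (#{w ∈ W | v ∈ linkN H (insert w Q)} : ℝ) := by
  obtain ⟨T, hT, hTj, hT1, hTp, hTH⟩ := hH₁.exists_tuple_degSet_ge j hne
  obtain ⟨x, hx⟩ := card_eq_one.1 (hTp i hij)
  have hxi : x ∈ T ∩ parts i := hx ▸ mem_singleton_self x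
  have hxp : x ∈ parts i := (mem_inter.1 hxi).2
  rw [hH₁.degSet_eq (by omega) hT] at hT1 hTH
  set D₁ := linkN H₁ T with hD₁
  set D := linkN H T with hD
  have hD₁D : D₁ ⊆ D := linkN_mono hsub T
  have hD₁ne : D₁.Nonempty := card_pos.1 (by omega)
  have hDne : D.Nonempty := hD₁ne.mono hD₁D
  have hDj : D ⊆ parts j := hH.linkN_subset hTj
  have hd₁ : (0 : ℝ) < #D₁ := by exact_mod_cast card_pos.2 hD₁ne
  have hd : (0 : ℝ) < #D := by exact_mod_cast card_pos.2 hDne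
  have hDY : (#D : ℝ) ≤ Y := by
    rw [hD, ← hH.degSet_eq (by omega) hT]
    exact hdeg j T hT hTj
  set P : ℝ := (n : ℝ) ^ (r - 3) with hP
  have hPpos : 0 < P := by positivity
  set E : ℝ := P * Y with hEdef
  have hEpos : 0 < E := by positivity
  have hLpos : 0 ≤ L := by rw [hL]; positivity
  have hE : ∀ v ∈ D, (#{R ∈ tuplesThrough r x | v ∈ linkN H R} : ℝ) ≤ E := fun v hv =>
    hH.card_tuplesThrough_filter_mem_linkN_le hij hik hjk hxp (hDj hv) hY.le (hdeg k)
  set 𝓡 := {R ∈ tuplesThrough r x | θ * #D ≤ (#(linkN H R ∩ D) : ℝ)} with h𝓡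
  have h𝓡card : (#𝓡 : ℝ) * θ ≤ E :=
    card_filter_large_mul_le (tuplesThrough r x) (linkN H) D E θ hDne hE
  have hrich : ∀ v ∈ D₁, q * E ≤ (#{R ∈ 𝓡 | v ∈ linkN H R} : ℝ) := by
    intro v hv
    have h1 := (harrow T hT hTj (by rw [hH₁.degSet_eq (by omega) hT]; omega) v hv x hxi).le_card
      hH (by omega) hT hL
    have h2 := le_card_filter_large_of_dense (tuplesThrough r x) (linkN H) D s v (hD₁D hv) L E
      (1 / r) θ hLpos hθ.le (hE v (hD₁D hv)) h1 (by rw [hLq, hθq])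
    calc q * E = L * (1 / r) / 2 := by rw [hLq]; ring
      _ ≤ _ := h2
      _ ≤ _ := by
        refine Nat.cast_le.2 (card_le_card fun R hR => ?_)
        rw [mem_filter] at hR
        rw [h𝓡, mem_filter, mem_filter]
        exact ⟨⟨hR.1, hR.2.2⟩, hR.2.1⟩
  have hlink : ∀ R ∈ 𝓡, x ∈ R ∧ R ∩ parts j = ∅ ∧ ∀ p, p ≠ j → #(R ∩ parts p) = 1 := by
    intro R hR
    rw [h𝓡, mem_filter, mem_tuplesThrough] at hR
    refine ⟨hR.1.2, ?_⟩
    have hpos : (0 : ℝ) < (#(linkN H R ∩ D) : ℝ) := lt_of_lt_of_le (mul_pos hθ hd) hR.2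
    obtain ⟨v, hv⟩ := card_pos.1 (Nat.cast_pos.1 hpos)
    rw [mem_inter] at hv
    exact hH.inter_of_mem_linkN hv.1 (hDj hv.2)
  have himage : (#(𝓡.image fun R => R \ parts k) : ℝ) ≤ P := by
    have hJ : #(univ \ {i, j, k} : Finset (Fin r)) = r - 3 := by
      rw [card_sdiff_of_subset (subset_univ _), card_univ, Fintype.card_fin,
        card_eq_three.2 ⟨i, j, k, hij, hik, hjk, rfl⟩]
    have : #(𝓡.image fun R => R \ parts k) ≤ n ^ (r - 3) := by
      rw [← hJ]
      refine hH.card_transversal_le _ (fun y => if y = i then {x} else ∅) _ ?_ ?_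
      · intro A hA y hy
        obtain ⟨R, hR, rfl⟩ := mem_image.1 hA
        simp only [mem_sdiff, mem_univ, true_and, mem_insert, mem_singleton, not_or] at hy
        rw [hH.sdiff_inter_of_ne R hy.2.2]
        exact (hlink R hR).2.2 y hy.2.1
      · intro A hA y hy
        obtain ⟨R, hR, rfl⟩ := mem_image.1 hA
        obtain ⟨h1, h2, h3⟩ := hlink R hR
        simp only [mem_sdiff, mem_univ, true_and, not_not, mem_insert, mem_singleton] at hy
        rcases hy with rfl | rfl | rfl
        · rw [if_pos rfl, hH.sdiff_inter_of_ne R hik]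
          exact inter_eq_singleton h1 hxp (h3 _ hij)
        · rw [if_neg hij.symm, hH.sdiff_inter_of_ne R hjk]
          exact h2
        · rw [if_neg hik.symm]
          exact sdiff_inter_self _ _
    rw [hP]
    exact_mod_cast this
  have h𝓡ne : 𝓡.Nonempty := by
    obtain ⟨v, hv⟩ := hD₁ne
    have h1 : (0 : ℝ) < (#{R ∈ 𝓡 | v ∈ linkN H R} : ℝ) :=
      lt_of_lt_of_le (mul_pos hq hEpos) (hrich v hv)
    exact (card_pos.1 (Nat.cast_pos.1 h1)).mono (filter_subset _ _)
  have hsum : ∑ Q ∈ 𝓡.image (fun R => R \ parts k),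
        (#D₁ * (q * θ / 2) * (#{R ∈ 𝓡 | R \ parts k = Q} : ℝ) + #D₁ * (q * Y / 2)) ≤
      ∑ Q ∈ 𝓡.image (fun R => R \ parts k),
        ∑ v ∈ D₁, (#{R ∈ 𝓡 | v ∈ linkN H R ∧ R \ parts k = Q} : ℝ) := by
    rw [sum_add_distrib, ← mul_sum, ← Nat.cast_sum, ← card_eq_sum_card_image, sum_const,
      nsmul_eq_mul, sum_comm]
    calc #D₁ * (q * θ / 2) * (#𝓡 : ℝ)
          + (#(𝓡.image fun R => R \ parts k) : ℝ) * (#D₁ * (q * Y / 2))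
        ≤ #D₁ * (q / 2) * E + P * (#D₁ * (q * Y / 2)) := by
          refine add_le_add ?_ (mul_le_mul_of_nonneg_right himage (by positivity))
          calc #D₁ * (q * θ / 2) * (#𝓡 : ℝ) = #D₁ * (q / 2) * (#𝓡 * θ) := by ring
            _ ≤ _ := mul_le_mul_of_nonneg_left h𝓡card (by positivity)
      _ = #D₁ • (q * E) := by rw [nsmul_eq_mul, hEdef]; ring
      _ ≤ ∑ v ∈ D₁, (#{R ∈ 𝓡 | v ∈ linkN H R} : ℝ) := card_nsmul_le_sum _ _ _ hrich
      _ ≤ _ := by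
        refine sum_le_sum fun v _ => ?_
        rw [card_eq_sum_card_fiberwise (f := fun R => R \ parts k)
          (t := 𝓡.image fun R => R \ parts k)
          (fun R hR => mem_image_of_mem _ (mem_filter.1 hR).1), Nat.cast_sum]
        refine le_of_eq (sum_congr rfl fun Q _ => ?_)
        rw [filter_filter]
  obtain ⟨Q, hQ, hQle⟩ := exists_le_of_sum_le (h𝓡ne.image _) hsum
  obtain ⟨R₀, hR₀, hQR₀⟩ := mem_image.1 hQ
  have hQk : Disjoint Q (parts k) := hQR₀ ▸ sdiff_disjoint
  refine ⟨D₁, Q, {w ∈ parts k | insert w Q ∈ 𝓡}, hD₁D.trans hDj, hD₁ne,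
    le_trans (Nat.cast_le.2 (card_le_card hD₁D)) hDY, hTH, hQk, filter_subset _ _, ?_⟩
  calc (#D₁ : ℝ) * (q * θ / 2 * #{w ∈ parts k | insert w Q ∈ 𝓡} + q * Y / 2)
      ≤ #D₁ * (q * θ / 2 * (#{R ∈ 𝓡 | R \ parts k = Q} : ℝ) + q * Y / 2) := by
        have hle : (#{w ∈ parts k | insert w Q ∈ 𝓡} : ℝ) ≤ #{R ∈ 𝓡 | R \ parts k = Q} := by
          refine Nat.cast_le.2 (card_le_card_of_injOn (fun w => insert w Q) ?_ ?_)
          · intro w hw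
            rw [mem_coe, mem_filter] at hw
            rw [mem_coe, mem_filter]
            refine ⟨hw.2, ?_⟩
            rw [insert_sdiff_of_mem _ hw.1, sdiff_eq_self_of_disjoint hQk]
          · intro w hw w' hw' h
            rw [mem_coe, mem_filter] at hw hw'
            have h1 : w ∈ insert w' Q := by
              have h0 : insert w Q = insert w' Q := h
              exact h0 ▸ mem_insert_self w Q
            exact (mem_insert.1 h1).resolve_right fun h2 => disjoint_left.1 hQk h2 hw.1
        have h1 : 0 ≤ q * θ / 2 := by positivity
        exact mul_le_mul_of_nonneg_left
          (add_le_add (mul_le_mul_of_nonneg_left hle h1) le_rfl) hd₁.le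
    _ = #D₁ * (q * θ / 2) * (#{R ∈ 𝓡 | R \ parts k = Q} : ℝ) + #D₁ * (q * Y / 2) := by ring
    _ ≤ _ := hQle
    _ ≤ _ := by
      refine sum_le_sum fun v _ => Nat.cast_le.2 ?_
      refine (card_le_card fun R hR => ?_).trans
        (card_image_le (f := fun w => insert w Q))
      rw [mem_filter] at hR
      obtain ⟨hR, hvR, hRQ⟩ := hR
      obtain ⟨w, hw⟩ := card_eq_one.1 ((hlink R hR).2.2 k hjk.symm)
      have hwR : w ∈ R ∩ parts k := hw ▸ mem_singleton_self w
      have hins : insert w Q = R := by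
        rw [insert_eq, ← hw, ← hRQ, union_comm, sdiff_union_inter]
      exact mem_image.2 ⟨w, mem_filter.2 ⟨mem_filter.2 ⟨(mem_inter.1 hwR).2, hins ▸ hR⟩,
        hins ▸ hvR⟩, hins⟩

/-- The second arrow bounds the moments of the degrees in a link graph. -/
lemma Arrow.sum_pow_le {t : ℕ} (hr : 3 ≤ r) (hs : 1 ≤ s) {H G₁ G : Finset (Finset V)}
    (hHG₁ : H ⊆ G₁) (hG₁G : G₁ ⊆ G) (hG₁ : IsPartite r n parts G₁) (hG : IsPartite r n parts G)
    (hfree : KstFree r s t G) {i j k : Fin r} (hij : i ≠ j) (hik : i ≠ k) (hjk : j ≠ k)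
    {δ Y L q θ : ℝ} (hY : 0 < Y) (hn : 1 ≤ n) (hθ : 0 < θ)
    (hθq : θ ^ (s - 1) = q)
    (hdeg : ∀ l, ∀ T : Finset V, #T = r - 1 → Disjoint T (parts l) → (degSet G T : ℝ) ≤ Y)
    (hL : L = (n : ℝ) ^ ((r : ℝ) - 2 - 1 / ((s : ℝ) - 1) - δ))
    (hLq : L * (1 / r) = 2 * (q * ((n : ℝ) ^ (r - 3) * Y)))
    (harrow : Arrow r s n parts G₁ G j k δ) (D Q W : Finset V) (hD : D ⊆ parts j)
    (hDY : (#D : ℝ) ≤ Y) (hQ : Disjoint Q (parts k)) (hW : W ⊆ parts k) :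
    q ^ (s + 1) * ∑ v ∈ D, (#{w ∈ W | v ∈ linkN H (insert w Q)} : ℝ) ^ s ≤
      (s ^ s * s.factorial : ℕ) * (2 * (t * r : ℕ) * (#W : ℝ) ^ s +
        ∑ v ∈ D, (#{w ∈ W | v ∈ linkN H (insert w Q)} : ℝ)) := by
  set A : V → Finset V := fun v => {w ∈ W | v ∈ linkN H (insert w Q)} with hA
  set K : ℕ := s ^ s * s.factorial with hK
  set E : ℝ := (n : ℝ) ^ (r - 3) * Y with hEdef
  have hEpos : 0 < E := by positivity
  have hLpos : 0 < L := by
    rw [hL]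
    have : (0 : ℝ) < n := by exact_mod_cast hn
    positivity
  have hrpos : (0 : ℝ) < 1 / r := by
    have : (0 : ℝ) < r := by exact_mod_cast (by omega : 0 < r)
    positivity
  have hcodeg : ∀ v ∈ D, ∀ w ∈ parts k,
      (#{R ∈ tuplesThrough r v | w ∈ linkN G R} : ℝ) ≤ E := fun v hv w hw =>
    hG.card_tuplesThrough_filter_mem_linkN_le hjk hij.symm hik.symm (hD hv) hw hY.le (hdeg i)
  have hmoment : ∀ v ∈ D, (#(A v) : ℝ) ^ s * (E * q ^ (s + 1)) ≤
      ∑ R ∈ tuplesThrough r v, (#(linkN G R ∩ A v) : ℝ) ^ s := by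
    intro v hv
    have hvk : v ∉ parts k := fun h => hjk (hG.eq_of_mem (hD hv) h)
    have hdisj : Disjoint (insert v Q) (parts k) := disjoint_insert_left.2 ⟨hvk, hQ⟩
    have hmem : ∀ w ∈ A v, w ∈ linkN G₁ (insert v Q) := by
      intro w hw
      rw [hA, mem_filter, mem_linkN] at hw
      rw [mem_linkN]
      refine ⟨fun h => disjoint_left.1 hdisj h (hW hw.1), hHG₁ ?_⟩
      rw [insert_comm]
      exact hw.2.2
    have h := pow_card_mul_le_sum_pow_card_inter (tuplesThrough r v) (linkN G)
      (linkN G (insert v Q)) (A v) (fun w hw => linkN_mono hG₁G _ (hmem w hw)) s L E (1 / r) θ hs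
      hLpos hrpos hθ hEpos (fun w hw => hcodeg v hv w (hG.linkN_subset hdisj hw))
      (fun w hw => by
        have hcard := hG₁.card_of_mem_linkN (hmem w hw)
        refine (harrow _ hcard hdisj ?_ w (hmem w hw) v
          (mem_inter.2 ⟨mem_insert_self _ _, hD hv⟩)).le_card hG (by omega) hcard hL
        rw [hG₁.degSet_eq (by omega) hcard]
        exact card_pos.2 ⟨w, hmem w hw⟩)
      (by rw [hLq, hθq])
    refine le_trans (le_of_eq ?_) h
    have hhalf : L * (1 / r) / 2 = q * E := by rw [hLq]; ring
    rw [hhalf, div_pow, hθq]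
    obtain ⟨u, rfl⟩ : ∃ u, s = u + 1 := ⟨s - 1, by omega⟩
    rw [Nat.add_sub_cancel]
    field_simp
    ring
  have herror : ∀ v ∈ D, ∑ R ∈ tuplesThrough r v, (#(linkN G R ∩ A v) : ℝ) ≤ #(A v) * E := by
    intro v hv
    have h := sum_card_filter_mem_eq_sum_card_inter (tuplesThrough r v) (linkN G) (A v)
    rw [← Nat.cast_sum, ← h, Nat.cast_sum, ← nsmul_eq_mul]
    exact sum_le_card_nsmul _ _ _ fun w hw => hcodeg v hv w (hW (mem_filter.1 hw).1)
  have hchoose : ∑ v ∈ D, ∑ R ∈ tuplesThrough r v, ((#(linkN G R ∩ A v)).choose s : ℝ) ≤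
      (#W : ℝ) ^ s * (2 * (t * r : ℕ) * E) := by
    calc ∑ v ∈ D, ∑ R ∈ tuplesThrough r v, ((#(linkN G R ∩ A v)).choose s : ℝ)
        ≤ ∑ v ∈ D, ∑ R ∈ tuplesThrough r v, (#{S ∈ W.powersetCard s | S ⊆ linkN G R} : ℝ) := by
          refine sum_le_sum fun v _ => sum_le_sum fun R _ => Nat.cast_le.2 ?_
          rw [← card_powersetCard]
          refine card_le_card fun S hS => ?_
          rw [mem_powersetCard] at hS
          rw [mem_filter, mem_powersetCard]
          exact ⟨⟨hS.1.trans (inter_subset_right.trans (filter_subset _ _)), hS.2⟩,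
            hS.1.trans inter_subset_left⟩
      _ = ∑ v ∈ D, ∑ S ∈ W.powersetCard s, (cdOn r G S v : ℝ) := by
          refine sum_congr rfl fun v _ => ?_
          have h := sum_card_bipartiteAbove_eq_sum_card_bipartiteBelow
            (fun (R S : Finset V) => S ⊆ linkN G R) (s := tuplesThrough r v)
            (t := W.powersetCard s)
          simp only [bipartiteAbove, bipartiteBelow] at h
          simp only [cdOn_eq]
          exact_mod_cast h
      _ = ∑ S ∈ W.powersetCard s, ∑ v ∈ D, (cdOn r G S v : ℝ) := sum_comm
      _ ≤ #(W.powersetCard s) • (2 * (t * r : ℕ) * E) := by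
          refine sum_le_card_nsmul _ _ _ fun S hS => ?_
          rw [mem_powersetCard] at hS
          exact hG.sum_cdOn_le hr hs hfree hij hik hjk hY.le (hdeg i) S D hS.2
            (hS.1.trans hW) hD hDY
      _ ≤ (#W : ℝ) ^ s * (2 * (t * r : ℕ) * E) := by
          rw [nsmul_eq_mul, card_powersetCard]
          refine mul_le_mul_of_nonneg_right ?_ (by positivity)
          exact_mod_cast Nat.choose_le_pow _ _
  refine le_of_mul_le_mul_right ?_ hEpos
  calc (q ^ (s + 1) * ∑ v ∈ D, (#(A v) : ℝ) ^ s) * E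
      = ∑ v ∈ D, (#(A v) : ℝ) ^ s * (E * q ^ (s + 1)) := by rw [← sum_mul]; ring
    _ ≤ ∑ v ∈ D, ∑ R ∈ tuplesThrough r v, (#(linkN G R ∩ A v) : ℝ) ^ s := sum_le_sum hmoment
    _ ≤ ∑ v ∈ D, ∑ R ∈ tuplesThrough r v, (K : ℝ) * (((#(linkN G R ∩ A v)).choose s : ℝ)
          + (#(linkN G R ∩ A v) : ℝ)) := by
        refine sum_le_sum fun v _ => sum_le_sum fun R _ => ?_
        exact_mod_cast pow_le_choose_add s _ hs
    _ = (K : ℝ) * (∑ v ∈ D, ∑ R ∈ tuplesThrough r v, ((#(linkN G R ∩ A v)).choose s : ℝ)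
          + ∑ v ∈ D, ∑ R ∈ tuplesThrough r v, (#(linkN G R ∩ A v) : ℝ)) := by
        simp only [← mul_sum, sum_add_distrib]
    _ ≤ (K : ℝ) * ((#W : ℝ) ^ s * (2 * (t * r : ℕ) * E) + ∑ v ∈ D, (#(A v) : ℝ) * E) :=
        mul_le_mul_of_nonneg_left (add_le_add hchoose (sum_le_sum herror)) (Nat.cast_nonneg _)
    _ = (K : ℝ) * (2 * (t * r : ℕ) * (#W : ℝ) ^ s + ∑ v ∈ D, (#(A v) : ℝ)) * E := by
        rw [← sum_mul]
        ring

end Arrows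

/-- A bounded `s`-th moment is incompatible with a large and dense degree sequence. -/
lemma mul_pow_le_of_sum_pow_le {ι : Type} (D : Finset ι) (a : ι → ℝ) (ha : ∀ v ∈ D, 0 ≤ a v)
    (hD : D.Nonempty) {s : ℕ} (hs : 1 ≤ s) {q θ Y K c M : ℝ} (hq : 0 < q) (hθ : 0 < θ)
    (hY : 0 < Y) (hM : 0 ≤ M) (haM : ∀ v ∈ D, a v ≤ M)
    (hlow : #D * (q * θ / 2 * M + q * Y / 2) ≤ ∑ v ∈ D, a v)
    (hup : q ^ (s + 1) * ∑ v ∈ D, a v ^ s ≤ K * (c * M ^ s + ∑ v ∈ D, a v))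
    (hlarge : 2 * K ≤ q ^ (s + 1) * (q * Y / 2) ^ (s - 1)) :
    #D * q ^ (s + 1) * (q * θ / 2) ^ s ≤ 2 * K * c := by
  obtain ⟨u, rfl⟩ : ∃ u, s = u + 1 := ⟨s - 1, by omega⟩
  rw [Nat.add_sub_cancel] at hlarge
  have hd : (0 : ℝ) < #D := by exact_mod_cast card_pos.2 hD
  have hle : ∑ v ∈ D, a v ≤ #D * M := by
    rw [← nsmul_eq_mul]
    exact sum_le_card_nsmul _ _ _ haM
  have hpm := pow_sum_div_card_le_sum_pow ha u
  obtain ⟨y, hey⟩ : ∃ y, ∑ v ∈ D, a v = #D * y :=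
    ⟨(∑ v ∈ D, a v) / #D, (mul_div_cancel₀ _ hd.ne').symm⟩
  rw [hey] at hle hlow hup hpm
  have hylow : q * θ / 2 * M + q * Y / 2 ≤ y := le_of_mul_le_mul_left hlow hd
  have hqθ : 0 < q * θ / 2 := by positivity
  have hqY : 0 < q * Y / 2 := by positivity
  have hy1 : q * θ / 2 * M ≤ y := by linarith
  have hy2 : q * Y / 2 ≤ y := by nlinarith
  have hypos : 0 < y := lt_of_lt_of_le hqY hy2
  have hMpos : 0 < M := lt_of_lt_of_le hypos (le_of_mul_le_mul_left hle hd)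
  have hpm' : #D * y ^ (u + 1) ≤ ∑ v ∈ D, a v ^ (u + 1) := by
    refine le_trans (le_of_eq ?_) hpm
    field_simp
    ring
  have h1 : q ^ (u + 1 + 1) * (#D * y ^ (u + 1)) ≤ K * (c * M ^ (u + 1) + #D * y) :=
    (mul_le_mul_of_nonneg_left hpm' (by positivity)).trans hup
  have h2 : 2 * K * (#D * y) ≤ q ^ (u + 1 + 1) * (#D * y ^ (u + 1)) := by
    calc 2 * K * (#D * y) ≤ q ^ (u + 1 + 1) * (q * Y / 2) ^ u * (#D * y) :=
          mul_le_mul_of_nonneg_right hlarge (by positivity)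
      _ ≤ q ^ (u + 1 + 1) * y ^ u * (#D * y) := by gcongr
      _ = _ := by ring
  have h3 : q ^ (u + 1 + 1) * (#D * y ^ (u + 1)) ≤ 2 * K * c * M ^ (u + 1) := by linarith
  have h4 : (q * θ / 2 * M) ^ (u + 1) ≤ y ^ (u + 1) := by gcongr
  refine le_of_mul_le_mul_right ?_ (pow_pos hMpos (u + 1))
  calc #D * q ^ (u + 1 + 1) * (q * θ / 2) ^ (u + 1) * M ^ (u + 1)
      = q ^ (u + 1 + 1) * (#D * (q * θ / 2 * M) ^ (u + 1)) := by rw [mul_pow _ M]; ring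
    _ ≤ q ^ (u + 1 + 1) * (#D * y ^ (u + 1)) := by gcongr
    _ ≤ _ := h3

lemma eventually_lt_mul_rpow (B : ℝ) {C e : ℝ} (hC : 0 < C) (he : 0 < e) :
    ∀ᶠ n : ℕ in Filter.atTop, B < C * (n : ℝ) ^ e :=
  (((tendsto_rpow_atTop he).comp tendsto_natCast_atTop_atTop).const_mul_atTop
    hC).eventually_gt_atTop B

lemma eventually_lt_degree_conditions {s : ℕ} (hs : 3 ≤ s) {ε δ : ℝ} (hε : 0 < ε) (hδ : 0 < δ)
    (h : 6 * ((s : ℝ) + 1) * (ε + δ) ≤ 1) {b : ℝ} (hb : 0 < b) (B₁ B₂ : ℝ) :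
    ∀ᶠ n : ℕ in Filter.atTop, ∀ q θ : ℝ, q = (n : ℝ) ^ (-(ε + δ)) * b →
      θ = q ^ (1 / ((s : ℝ) - 1)) →
      B₁ < q ^ (s + 1) * (q * (n : ℝ) ^ (1 - 1 / ((s : ℝ) - 1) + ε) / 2) ^ (s - 1) ∧
      B₂ < (n : ℝ) ^ (1 - 1 / ((s : ℝ) - 1) - ε) * q ^ (s + 1) * (q * θ / 2) ^ s := by
  have hs' : (3 : ℝ) ≤ s := by exact_mod_cast hs
  set a : ℝ := 1 / ((s : ℝ) - 1) with ha
  have has : a * ((s : ℝ) - 1) = 1 := by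
    rw [ha]
    exact one_div_mul_cancel (by linarith)
  have hapos : 0 < a := by
    rw [ha]
    exact one_div_pos.2 (by linarith)
  set η := ε + δ with hη
  have hηpos : 0 < η := by positivity
  have hcast : ((s - 1 : ℕ) : ℝ) = (s : ℝ) - 1 := by
    rw [Nat.cast_sub (by omega), Nat.cast_one]
  have hηs : η * (2 * (s : ℝ) ^ 2 + s - 2) < s - 2 := by
    have h1 : 6 * ((s : ℝ) + 1) * η * (s - 2) ≤ 1 * (s - 2) :=
      mul_le_mul_of_nonneg_right h (by linarith)
    have h2 : 0 < η * (4 * (s : ℝ) ^ 2 - 7 * s - 10) := mul_pos hηpos (by nlinarith)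
    linarith
  have he₁ : 0 < -η * ((s + 1 : ℕ) : ℝ) + (-η + (1 - a + ε)) * ((s - 1 : ℕ) : ℝ) := by
    rw [hcast]
    push_cast
    have h1 : 0 < ε * ((s : ℝ) - 1) := mul_pos hε (by linarith)
    have h2 : 0 ≤ η * (2 * (s : ℝ) ^ 2 - s - 2) := mul_nonneg hηpos.le (by nlinarith)
    linarith
  have he₂ : 0 < (1 - a - ε) + -η * ((s + 1 : ℕ) : ℝ) + (-η + -η * a) * (s : ℝ) := by
    have hεη : ε * ((s : ℝ) - 1) ≤ η * ((s : ℝ) - 1) :=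
      mul_le_mul_of_nonneg_right (by linarith) (by linarith)
    refine pos_of_mul_pos_left (b := (s : ℝ) - 1) ?_ (by linarith)
    push_cast
    have h3 : ((1 - a - ε) + -η * ((s : ℝ) + 1) + (-η + -η * a) * (s : ℝ)) * ((s : ℝ) - 1) =
        (s - 1) - a * (s - 1) - ε * (s - 1) - η * ((2 * s + 1) * (s - 1))
          - η * s * (a * (s - 1)) := by ring
    rw [h3, has]
    linarith
  filter_upwards [eventually_lt_mul_rpow B₁ (C := b ^ (s + 1) * (b / 2) ^ (s - 1))
      (by positivity) he₁,
    eventually_lt_mul_rpow B₂ (C := b ^ (s + 1) * (b * b ^ a / 2) ^ s) (by positivity) he₂,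
    Filter.eventually_ge_atTop 1] with n h1 h2 hn q θ hq hθ
  have hx : (0 : ℝ) < n := by exact_mod_cast hn
  have hθ' : θ = (n : ℝ) ^ (-η * a) * b ^ a := by
    rw [hθ, hq, Real.mul_rpow (by positivity) hb.le, ← Real.rpow_mul hx.le]
  constructor
  · refine lt_of_lt_of_eq h1 ?_
    rw [hq, Real.rpow_add hx, Real.rpow_mul_natCast hx.le, Real.rpow_mul_natCast hx.le,
      Real.rpow_add hx]
    simp only [mul_pow, div_pow]
    ring
  · refine lt_of_lt_of_eq h2 ?_
    rw [hq, hθ', Real.rpow_add hx, Real.rpow_add hx, Real.rpow_mul_natCast hx.le,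
      Real.rpow_mul_natCast hx.le, Real.rpow_add hx]
    simp only [mul_pow, div_pow]
    ring

lemma RegularHG.degSet_le {r s n : ℕ} {parts : Fin r → Finset V} {G : Finset (Finset V)}
    {ε α : ℝ} (h : RegularHG r s n parts G ε α) (l : Fin r) (T : Finset V) (hT : #T = r - 1)
    (hl : Disjoint T (parts l)) :
    (degSet G T : ℝ) ≤ (n : ℝ) ^ (1 - 1 / ((s : ℝ) - 1) + ε) := by
  obtain ⟨Δ, -, hΔ, hreg⟩ := h.2 l
  rcases Nat.eq_zero_or_pos (degSet G T) with h0 | h1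
  · rw [h0, Nat.cast_zero]
    positivity
  · exact (hreg T hT hl h1).2.trans hΔ

theorem stmt_15 (r s t : ℕ) (hr : 3 ≤ r) (hs : 3 ≤ s) (ht : 1 ≤ t)
    (ε δ : ℝ) (hε : 0 < ε) (hδ : 0 < δ)
    (h1 : 6 * ((s : ℝ) + 1) * (ε + δ) ≤ 1)
    (α : ℕ → ℝ) (hα : α =o[Filter.atTop] fun n => (n : ℝ) ^ ε) :
    ∃ n₀ : ℕ, ∀ n ≥ n₀, ∀ (V : Type) [Fintype V],
      ∀ (parts : Fin r → Finset V) (H₁ H G₁ G : Finset (Finset V)),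
        H₁ ⊆ H → H ⊆ G₁ → G₁ ⊆ G →
        IsPartite r n parts H₁ → IsPartite r n parts H →
        IsPartite r n parts G₁ → IsPartite r n parts G →
        RegularHG r s n parts H₁ ε (α n) → RegularHG r s n parts H ε (α n) →
        RegularHG r s n parts G₁ ε (α n) → RegularHG r s n parts G ε (α n) →
        KstFree r s t H₁ → KstFree r s t H → KstFree r s t G₁ → KstFree r s t G →
        ∀ i j k : Fin r, j ≠ i → j ≠ k →
          Arrow r s n parts H₁ H i j δ → Arrow r s n parts G₁ G j k δ →
          k = i := by
  set K : ℕ := s ^ s * s.factorial with hK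
  have hr0 : (0 : ℝ) < r := by exact_mod_cast (by omega : 0 < r)
  have hs' : (3 : ℝ) ≤ s := by exact_mod_cast hs
  have hev := (eventually_lt_degree_conditions hs hε hδ h1 (b := 1 / (2 * r)) (by positivity)
    (2 * K) (2 * K * (2 * (t * r : ℕ)))).and (Filter.eventually_ge_atTop 1)
  obtain ⟨n₀, hn₀⟩ := Filter.eventually_atTop.1 hev
  refine ⟨n₀, fun n hn V _ parts H₁ H G₁ G hH₁H hHG₁ hG₁G pH₁ pH pG₁ pG rH₁ rH rG₁ rG
    _ _ _ fG i j k hji hjk aH aG => ?_⟩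
  by_contra hki
  obtain ⟨hbig, hn1⟩ := hn₀ n hn
  have hx : (0 : ℝ) < n := by exact_mod_cast hn1
  set q : ℝ := (n : ℝ) ^ (-(ε + δ)) * (1 / (2 * r)) with hq
  set θ : ℝ := q ^ (1 / ((s : ℝ) - 1)) with hθ
  set Y : ℝ := (n : ℝ) ^ (1 - 1 / ((s : ℝ) - 1) + ε) with hY
  set L : ℝ := (n : ℝ) ^ ((r : ℝ) - 2 - 1 / ((s : ℝ) - 1) - δ) with hL
  obtain ⟨hbig₁, hbig₂⟩ := hbig q θ rfl rfl
  have hq0 : 0 < q := by positivity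
  have hθ0 : 0 < θ := by positivity
  have hY0 : 0 < Y := by positivity
  have hθq : θ ^ (s - 1) = q := by
    rw [hθ, ← Real.rpow_mul_natCast hq0.le, Nat.cast_sub (by omega), Nat.cast_one,
      one_div_mul_cancel (by linarith), Real.rpow_one]
  have hLq : L * (1 / r) = 2 * (q * ((n : ℝ) ^ (r - 3) * Y)) := by
    have h2 : L = (n : ℝ) ^ (-(ε + δ)) * ((n : ℝ) ^ (r - 3) * Y) := by
      rw [hL, hY, ← Real.rpow_natCast, ← Real.rpow_add hx, ← Real.rpow_add hx,
        Nat.cast_sub (by omega)]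
      congr 1
      push_cast
      ring
    rw [h2, hq]
    field_simp
  have hdegG := rG.degSet_le
  have hdegH : ∀ l, ∀ T : Finset V, #T = r - 1 → Disjoint T (parts l) → (degSet H T : ℝ) ≤ Y :=
    fun l T hT hl => le_trans (Nat.cast_le.2 (degSet_mono (hHG₁.trans hG₁G) T)) (hdegG l T hT hl)
  have hne : H₁.Nonempty := by
    have h2 : (0 : ℝ) < #H₁ := lt_of_lt_of_le (by positivity) rH₁.1
    exact card_pos.1 (Nat.cast_pos.1 h2)
  obtain ⟨D, Q, W, hDj, hDne, hDY, hDH₁, hQk, hWk, hdense⟩ := aH.exists_dense_link hr hH₁H pH₁ pH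
    hne hji.symm (Ne.symm hki) hjk hY0 hn1 hq0 hθ0 hθq hdegH hL hLq
  have hmoment := aG.sum_pow_le hr (by omega : 1 ≤ s) hHG₁ hG₁G pG₁ pG fG hji.symm (Ne.symm hki)
    hjk hY0 hn1 hθ0 hθq hdegG hL hLq D Q W hDj hDY hQk hWk
  have hcontra := mul_pow_le_of_sum_pow_le D
    (fun v => (#{w ∈ W | v ∈ linkN H (insert w Q)} : ℝ)) (fun _ _ => Nat.cast_nonneg _) hDne
    (by omega : 1 ≤ s) hq0 hθ0 hY0 (Nat.cast_nonneg #W)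
    (fun v _ => Nat.cast_le.2 (card_le_card (filter_subset _ _))) hdense hmoment hbig₁.le
  have hDlarge : (n : ℝ) ^ (1 - 1 / ((s : ℝ) - 1) - ε) ≤ #D := by
    have h2 : (n : ℝ) ^ ((r : ℝ) - 1 / ((s : ℝ) - 1) - ε) =
        (n : ℝ) ^ (r - 1) * (n : ℝ) ^ (1 - 1 / ((s : ℝ) - 1) - ε) := by
      rw [← Real.rpow_natCast, ← Real.rpow_add hx, Nat.cast_sub (by omega)]
      congr 1
      push_cast
      ring
    have h3 : (#H₁ : ℝ) ≤ (n : ℝ) ^ (r - 1) * #D := by exact_mod_cast hDH₁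
    exact le_of_mul_le_mul_left (h2 ▸ rH₁.1.trans h3) (by positivity)
  refine absurd hcontra (not_le.2 (lt_of_lt_of_le hbig₂ ?_))
  exact mul_le_mul_of_nonneg_right (mul_le_mul_of_nonneg_right hDlarge (by positivity))
    (by positivity)

end
end
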